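/- Every Borel subset of the body of a nonempty pruned tree is universally unravelable, hence unravelable. -/

import Mathlib

universe u

namespace GS

variable {A B C : Type u}

/-- A tree on `A`: a set of finite sequences closed under prefixes. -/
def IsTree (T : Set (List A)) : Prop := ∀ ⦃x y : List A⦄, x <+: y → y ∈ T → x ∈ T

/-- A tree is pruned if every node has a proper extension in the tree. -/
def IsPruned (T : Set (List A)) : Prop := ∀ x ∈ T, ∃ a : A, x ++ [a] ∈ T

/-- The body of a tree: infinite sequences all of whose finite prefixes lie in the tree. -/
def body (T : Set (List A)) : Set (ℕ → A) :=
  {a | ∀ n : ℕ, (List.ofFn fun i : Fin n => a i) ∈ T}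

/-- The product of the discrete topologies on `ℕ → A`. -/
def seqTop (A : Type u) : TopologicalSpace (ℕ → A) :=
  @Pi.topologicalSpace ℕ (fun _ => A) (fun _ => ⊥)

/-- The subspace topology on the body of a tree. -/
def bodyTop (T : Set (List A)) : TopologicalSpace {a // a ∈ body T} :=
  TopologicalSpace.induced Subtype.val (seqTop A)

/-- A (functional) strategy for player `i` on the tree `T`: to each position of player `i`
(i.e. of length `≡ i (mod 2)`) in `T` it assigns a legal move. -/
structure Strategy (T : Set (List A)) (i : ℕ) where
  move : List A → A
  legal : ∀ x ∈ T, x.length % 2 = i % 2 → x ++ [move x] ∈ T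

/-- A play is consistent with a strategy of player `i` if all moves of player `i` are
given by the strategy. -/
def Consistent {T : Set (List A)} {i : ℕ} (σ : Strategy T i) (a : ℕ → A) : Prop :=
  ∀ n : ℕ, n % 2 = i % 2 → a n = σ.move (List.ofFn fun j : Fin n => a j)

/-- The plays (branches of the tree) consistent with a strategy; this is the body `[σ]`
of the strategy tree of `σ`. -/
def plays {T : Set (List A)} {i : ℕ} (σ : Strategy T i) : Set (ℕ → A) :=
  {a ∈ body T | Consistent σ a}

/-- A strategy of player `i` is winning in the game `(T, P)` if every play consistent with it
is won by player `i`. -/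
def WinningStrategy (T : Set (List A)) (P : Set (ℕ → A)) {i : ℕ} (σ : Strategy T i) : Prop :=
  ∀ a ∈ plays σ, if i % 2 = 0 then a ∈ P else a ∉ P

/-- A game is determined if one of the two players has a winning strategy. -/
def Determined (T : Set (List A)) (P : Set (ℕ → A)) : Prop :=
  (∃ σ : Strategy T 0, WinningStrategy T P σ) ∨ ∃ σ : Strategy T 1, WinningStrategy T P σ

/-- The strategy tree of a functional strategy: all positions reachable while player `i`
follows `σ`. -/
def stratTree (T : Set (List A)) (i : ℕ) (σ : Strategy T i) : Set (List A) :=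
  {x ∈ T | ∀ (y : List A) (a : A), y ++ [a] <+: x → y.length % 2 = i % 2 → a = σ.move y}

/-- A morphism of trees: an isotone, length-preserving map. -/
structure TreeHom (S : Set (List A)) (T : Set (List B)) where
  toFun : List A → List B
  mem : ∀ x ∈ S, toFun x ∈ T
  len : ∀ x ∈ S, (toFun x).length = x.length
  mono : ∀ ⦃x y : List A⦄, x ∈ S → y ∈ S → x <+: y → toFun x <+: toFun y

/-- The identity tree morphism. -/
def TreeHom.id (S : Set (List A)) : TreeHom S S where
  toFun := _root_.id
  mem _ hx := hx
  len _ _ := rfl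
  mono _ _ _ _ h := h

/-- Composition of tree morphisms. -/
def TreeHom.comp {S : Set (List A)} {T : Set (List B)} {U : Set (List C)}
    (g : TreeHom T U) (f : TreeHom S T) : TreeHom S U where
  toFun := g.toFun ∘ f.toFun
  mem x hx := g.mem _ (f.mem x hx)
  len x hx := by simp only [Function.comp_apply, g.len _ (f.mem x hx), f.len x hx]
  mono x y hx hy hxy := g.mono (f.mem x hx) (f.mem y hy) (f.mono hx hy hxy)

/-- The map induced on infinite branches by a length-preserving isotone map of trees. -/
def bodyMap [Inhabited B] (f : List A → List B) (a : ℕ → A) : ℕ → B :=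
  fun n => (f (List.ofFn fun i : Fin (n + 1) => a i)).getD n default

/-- A covering of trees: a tree morphism `π` together with a map `φ` of strategies (of either
player) satisfying the locality condition and the branch lifting condition. -/
structure Covering [Inhabited A] (S : Set (List B)) (T : Set (List A)) where
  π : TreeHom S T
  φ : ∀ i : ℕ, Strategy S i → Strategy T i
  agree : ∀ (i n : ℕ) (σ σ' : Strategy S i),
    (∀ x ∈ S, x.length ≤ n → σ.move x = σ'.move x) →
    ∀ x ∈ T, x.length ≤ n → (φ i σ).move x = (φ i σ').move x
  lift : ∀ (i : ℕ) (σ : Strategy S i), ∀ a ∈ plays (φ i σ),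
    ∃ a' ∈ plays σ, bodyMap π.toFun a' = a

/-- A covering is `k`-fixing if `π` restricts to a bijection on the first `k` levels and `φ` is
induced by `π` there. -/
structure IsFixing [Inhabited A] {S : Set (List B)} {T : Set (List A)} (k : ℕ)
    (c : Covering S T) : Prop where
  bij : Function.Bijective fun x : {x : List B // x ∈ S ∧ x.length ≤ k} =>
    (⟨c.π.toFun x.1, c.π.mem _ x.2.1, by rw [c.π.len _ x.2.1]; exact x.2.2⟩ :
      {x : List A // x ∈ T ∧ x.length ≤ k})
  induced : ∀ (i : ℕ) (σ : Strategy S i), ∀ x ∈ S, x.length < k → x.length % 2 = i % 2 →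
    c.π.toFun (x ++ [σ.move x]) = c.π.toFun x ++ [(c.φ i σ).move (c.π.toFun x)]

/-- A game `(T, P)` is unravelable if for every `k` there is a `k`-fixing covering of `T` such
that the preimage of `P` is clopen in the body of the covering tree. -/
def Unravelable [Inhabited A] (T : Set (List A)) (P : Set (ℕ → A)) : Prop :=
  ∀ k : ℕ, ∃ (B : Type u) (S : Set (List B)) (c : Covering S T),
    IsTree S ∧ IsPruned S ∧ S.Nonempty ∧ IsFixing k c ∧
    @IsClopen _ (bodyTop S) {a : {a // a ∈ body S} | bodyMap c.π.toFun a.1 ∈ P}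

/-- A game `(T, P)` is universally unravelable if for every covering of `T` the game with the
preimage of `P` as payoff set is unravelable. -/
def UnivUnravelable [Inhabited A] (T : Set (List A)) (P : Set (ℕ → A)) : Prop :=
  ∀ (B : Type u) (_ : Inhabited B) (S : Set (List B)) (c : Covering S T),
    IsTree S → IsPruned S → S.Nonempty →
    Unravelable S (bodyMap c.π.toFun ⁻¹' P)

end GS


namespace GS

section Basics

variable {A B C : Type u}

/-- The initial segment of length `n` of an infinite sequence. -/
def pre (a : ℕ → A) (n : ℕ) : List A := List.ofFn fun i : Fin n => a i

@[simp] lemma length_pre (a : ℕ → A) (n : ℕ) : (pre a n).length = n := by simp [pre]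

@[simp] lemma pre_zero (a : ℕ → A) : pre a 0 = [] := by simp [pre]

@[simp] lemma getElem_pre (a : ℕ → A) (n j : ℕ) (h : j < (pre a n).length) :
    (pre a n)[j] = a j := by simp [pre]

lemma pre_succ (a : ℕ → A) (n : ℕ) : pre a (n + 1) = pre a n ++ [a n] := by
  apply List.ext_getElem
  · simp
  · intro j h1 h2
    simp only [length_pre] at h1
    rw [getElem_pre, List.getElem_append]
    split_ifs with h
    · simp
    · simp only [length_pre] at h
      have : j = n := by omega
      subst this; simp

lemma take_pre (a : ℕ → A) {m n : ℕ} (h : m ≤ n) : (pre a n).take m = pre a m := by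
  apply List.ext_getElem
  · simp [h]
  · intro j h1 h2
    simp

lemma pre_prefix (a : ℕ → A) {m n : ℕ} (h : m ≤ n) : pre a m <+: pre a n := by
  rw [← take_pre a h]; exact List.take_prefix _ _

lemma pre_congr {a b : ℕ → A} {n : ℕ} (h : ∀ i < n, a i = b i) : pre a n = pre b n := by
  apply List.ext_getElem
  · simp
  · intro j h1 h2
    simp only [length_pre] at h1
    simp [h j h1]

lemma pre_eq_apply {a b : ℕ → A} {n j : ℕ} (h : pre a n = pre b n) (hj : j < n) : a j = b j := by
  have h1 : (pre a n)[j]'(by simpa) = (pre b n)[j]'(by simpa) := by simp only [h]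
  simpa using h1

lemma prefix_pre_eq {a : ℕ → A} {x : List A} {n : ℕ} (h : x <+: pre a n) :
    x = pre a x.length := by
  have h1 := h.length_le
  rw [length_pre] at h1
  rw [← take_pre a h1]
  exact List.prefix_iff_eq_take.1 h

lemma map_pre (f : A → B) (a : ℕ → A) (n : ℕ) :
    (pre a n).map f = pre (fun j => f (a j)) n := by
  apply List.ext_getElem <;> simp

lemma mem_body {T : Set (List A)} {a : ℕ → A} : a ∈ body T ↔ ∀ n, pre a n ∈ T := Iff.rfl

lemma mem_plays {T : Set (List A)} {i : ℕ} {σ : Strategy T i} {a : ℕ → A} :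
    a ∈ plays σ ↔ (∀ n, pre a n ∈ T) ∧ ∀ n, n % 2 = i % 2 → a n = σ.move (pre a n) := Iff.rfl

lemma pre_bodyMap [Inhabited B] {S : Set (List A)} {T : Set (List B)} (f : TreeHom S T)
    {a : ℕ → A} (ha : a ∈ body S) (n : ℕ) : pre (bodyMap f.toFun a) n = f.toFun (pre a n) := by
  have hl := f.len _ (ha n)
  change (f.toFun (pre a n)).length = (pre a n).length at hl
  apply List.ext_getElem
  · simp [hl]
  · intro j h1 h2
    rw [getElem_pre]
    change (f.toFun (pre a (j + 1))).getD j default = _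
    rw [length_pre] at h1
    have hp := f.mono (ha (j + 1)) (ha n) (pre_prefix a h1)
    have hl' := f.len _ (ha (j + 1))
    change (f.toFun (pre a (j + 1))).length = (pre a (j + 1)).length at hl'
    rw [length_pre] at hl'
    have hj : j < (f.toFun (pre a (j + 1))).length := by omega
    rw [List.getD_eq_getElem _ _ hj]
    exact hp.getElem hj

lemma bodyMap_mem [Inhabited B] {S : Set (List A)} {T : Set (List B)} (f : TreeHom S T)
    {a : ℕ → A} (ha : a ∈ body S) : bodyMap f.toFun a ∈ body T := by
  intro n
  change pre _ n ∈ T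
  rw [pre_bodyMap f ha]
  exact f.mem _ (ha n)

lemma eq_of_pre_eq {a b : ℕ → A} (h : ∀ n, pre a n = pre b n) : a = b := by
  funext j
  exact pre_eq_apply (h (j + 1)) (Nat.lt_succ_self j)

lemma bodyMap_comp [Inhabited B] [Inhabited C] {S : Set (List A)} {T : Set (List B)}
    {U : Set (List C)} (g : TreeHom T U) (f : TreeHom S T) {a : ℕ → A} (ha : a ∈ body S) :
    bodyMap (g.comp f).toFun a = bodyMap g.toFun (bodyMap f.toFun a) := by
  apply eq_of_pre_eq
  intro n
  rw [pre_bodyMap _ ha, pre_bodyMap _ (bodyMap_mem f ha), pre_bodyMap f ha]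
  rfl

lemma bodyMap_id [Inhabited A] {T : Set (List A)} {a : ℕ → A} (ha : a ∈ body T) :
    bodyMap (TreeHom.id T).toFun a = a := by
  apply eq_of_pre_eq
  intro n
  rw [pre_bodyMap _ ha]
  rfl

lemma isOpen_body_iff {T : Set (List A)} {O : Set {a // a ∈ body T}} :
    @IsOpen _ (bodyTop T) O ↔ ∀ a ∈ O, ∃ n, ∀ b : {a // a ∈ body T},
      pre b.1 n = pre a.1 n → b ∈ O := by
  let tA : TopologicalSpace A := ⊥
  have : DiscreteTopology A := ⟨rfl⟩
  change @IsOpen _ (TopologicalSpace.induced Subtype.val (Pi.topologicalSpace)) O ↔ _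
  rw [isOpen_induced_iff]
  constructor
  · rintro ⟨V, hV, rfl⟩ a ha
    rw [isOpen_pi_iff] at hV
    obtain ⟨I, u, hu, hsub⟩ := hV a.1 ha
    refine ⟨I.sup id + 1, fun b hb => hsub fun j hj => ?_⟩
    have hbj : b.1 j = a.1 j := pre_eq_apply hb (Nat.lt_succ_of_le (Finset.le_sup (f := id) hj))
    rw [hbj]
    exact (hu j hj).2
  · intro h
    choose! N hN using h
    refine ⟨⋃ a ∈ O, {b | ∀ j < N a, b j = a.1 j}, ?_, ?_⟩
    · refine isOpen_biUnion fun a _ => ?_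
      have : {b : ℕ → A | ∀ j < N a, b j = a.1 j} =
          (Finset.range (N a) : Set ℕ).pi fun j => {a.1 j} := by
        ext b; simp [Set.mem_pi]
      rw [this]
      exact isOpen_set_pi (Finset.finite_toSet _) fun _ _ => isOpen_discrete _
    · ext b
      simp only [Set.mem_preimage, Set.mem_iUnion, Set.mem_ofPred_eq]
      constructor
      · rintro ⟨a, ha, hb⟩
        exact hN a ha b (pre_congr hb)
      · intro hb
        exact ⟨b, hb, fun _ _ => rfl⟩

lemma isOpen_preimage_body {S : Set (List A)} {T : Set (List B)} [Inhabited B] (f : TreeHom S T)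
    {P : Set (ℕ → B)} (h : @IsOpen _ (bodyTop T) {a | a.1 ∈ P}) :
    @IsOpen _ (bodyTop S) {a | bodyMap f.toFun a.1 ∈ P} := by
  rw [isOpen_body_iff] at h ⊢
  intro a ha
  obtain ⟨n, hn⟩ := h ⟨_, bodyMap_mem f a.2⟩ ha
  refine ⟨n, fun b hb => hn ⟨_, bodyMap_mem f b.2⟩ ?_⟩
  change pre (bodyMap f.toFun b.1) n = pre (bodyMap f.toFun a.1) n
  rw [pre_bodyMap f b.2, pre_bodyMap f a.2, hb]

lemma isOpen_congr_body {S : Set (List A)} {P Q : Set (ℕ → A)} (h : ∀ a ∈ body S, a ∈ P ↔ a ∈ Q)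
    (hP : @IsOpen _ (bodyTop S) {a | a.1 ∈ P}) : @IsOpen _ (bodyTop S) {a | a.1 ∈ Q} := by
  have : {a : {a // a ∈ body S} | a.1 ∈ Q} = {a | a.1 ∈ P} := by
    ext a; exact (h a.1 a.2).symm
  rwa [this]

/-- The payoff set is clopen in the body of the tree. -/
def ClopenIn (T : Set (List A)) (P : Set (ℕ → A)) : Prop :=
  @IsOpen _ (bodyTop T) {a | a.1 ∈ P} ∧ @IsOpen _ (bodyTop T) {a | a.1 ∈ Pᶜ}

lemma isClopen_body_iff {T : Set (List A)} {P : Set (ℕ → A)} :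
    @IsClopen _ (bodyTop T) {a : {a // a ∈ body T} | a.1 ∈ P} ↔ ClopenIn T P := by
  let := bodyTop T
  constructor
  · rintro ⟨h1, h2⟩
    exact ⟨h2, h1.isOpen_compl⟩
  · rintro ⟨h1, h2⟩
    exact ⟨⟨h2⟩, h1⟩

lemma ClopenIn.congr {S : Set (List A)} {P Q : Set (ℕ → A)} (h : ∀ a ∈ body S, a ∈ P ↔ a ∈ Q)
    (hP : ClopenIn S P) : ClopenIn S Q :=
  ⟨isOpen_congr_body h hP.1, isOpen_congr_body (fun a ha => not_congr (h a ha)) hP.2⟩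

lemma ClopenIn.preimage {S : Set (List A)} {T : Set (List B)} [Inhabited B] (f : TreeHom S T)
    {P : Set (ℕ → B)} (h : ClopenIn T P) : ClopenIn S (bodyMap f.toFun ⁻¹' P) :=
  ⟨isOpen_preimage_body f h.1, isOpen_preimage_body f h.2⟩

lemma ClopenIn.compl {S : Set (List A)} {P : Set (ℕ → A)} (h : ClopenIn S P) : ClopenIn S Pᶜ :=
  ⟨h.2, by rw [compl_compl]; exact h.1⟩

end Basics

section Coverings

variable {A B C : Type u}

/-- Composition of coverings. -/
def Covering.comp [Inhabited A] [Inhabited B] {T : Set (List A)} {S : Set (List B)}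
    {R : Set (List C)} (c : Covering S T) (d : Covering R S) : Covering R T where
  π := c.π.comp d.π
  φ i σ := c.φ i (d.φ i σ)
  agree i n σ σ' h := c.agree i n _ _ (d.agree i n _ _ h)
  lift i σ a ha := by
    obtain ⟨b, hb, rfl⟩ := c.lift i _ a ha
    obtain ⟨e, he, rfl⟩ := d.lift i _ b hb
    exact ⟨e, he, bodyMap_comp _ _ he.1⟩

/-- The identity covering. -/
def Covering.refl [Inhabited A] (T : Set (List A)) : Covering T T where
  π := TreeHom.id T
  φ _ σ := σ
  agree _ _ _ _ h := h
  lift _ _ a ha := ⟨a, ha, bodyMap_id ha.1⟩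

lemma isFixing_iff [Inhabited A] {S : Set (List B)} {T : Set (List A)} {k : ℕ}
    {c : Covering S T} : IsFixing k c ↔
      (∀ x ∈ S, ∀ y ∈ S, x.length ≤ k → c.π.toFun x = c.π.toFun y → x = y) ∧
      (∀ y ∈ T, y.length ≤ k → ∃ x ∈ S, c.π.toFun x = y) ∧
      ∀ (i : ℕ) (σ : Strategy S i), ∀ x ∈ S, x.length < k → x.length % 2 = i % 2 →
        c.π.toFun (x ++ [σ.move x]) = c.π.toFun x ++ [(c.φ i σ).move (c.π.toFun x)] := by
  constructor
  · rintro ⟨⟨h1, h2⟩, h3⟩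
    refine ⟨fun x hx y hy hk hxy => ?_, fun y hy hk => ?_, h3⟩
    · have hk' : y.length ≤ k := by rwa [← c.π.len y hy, ← hxy, c.π.len x hx]
      exact congrArg Subtype.val (@h1 ⟨x, hx, hk⟩ ⟨y, hy, hk'⟩ (Subtype.ext hxy))
    · obtain ⟨x, hx⟩ := h2 ⟨y, hy, hk⟩
      exact ⟨x.1, x.2.1, congrArg Subtype.val hx⟩
  · rintro ⟨h1, h2, h3⟩
    refine ⟨⟨fun x y hxy => ?_, fun y => ?_⟩, h3⟩
    · exact Subtype.ext (h1 _ x.2.1 _ y.2.1 x.2.2 (congrArg Subtype.val hxy))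
    · obtain ⟨x, hx, hxy⟩ := h2 y.1 y.2.1 y.2.2
      exact ⟨⟨x, hx, by rw [← c.π.len x hx, hxy]; exact y.2.2⟩, Subtype.ext hxy⟩

lemma IsFixing.of_le [Inhabited A] {S : Set (List B)} {T : Set (List A)} {k l : ℕ}
    {c : Covering S T} (h : IsFixing l c) (hkl : k ≤ l) : IsFixing k c := by
  rw [isFixing_iff] at h ⊢
  exact ⟨fun x hx y hy hk => h.1 x hx y hy (hk.trans hkl),
    fun y hy hk => h.2.1 y hy (hk.trans hkl),
    fun i σ x hx hk => h.2.2 i σ x hx (hk.trans_le hkl)⟩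

lemma IsFixing.comp [Inhabited A] [Inhabited B] {T : Set (List A)} {S : Set (List B)}
    {R : Set (List C)} {c : Covering S T} {d : Covering R S} {k : ℕ} (hc : IsFixing k c)
    (hd : IsFixing k d) : IsFixing k (c.comp d) := by
  rw [isFixing_iff] at hc hd ⊢
  obtain ⟨c1, c2, c3⟩ := hc
  obtain ⟨d1, d2, d3⟩ := hd
  refine ⟨fun x hx y hy hk hxy => ?_, fun y hy hk => ?_, fun i σ x hx hk hi => ?_⟩
  · exact d1 x hx y hy hk (c1 _ (d.π.mem x hx) _ (d.π.mem y hy) (by rwa [d.π.len x hx]) hxy)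
  · obtain ⟨z, hz, rfl⟩ := c2 y hy hk
    obtain ⟨x, hx, rfl⟩ := d2 z hz (by rwa [← c.π.len z hz])
    exact ⟨x, hx, rfl⟩
  · change c.π.toFun (d.π.toFun (x ++ [σ.move x])) = c.π.toFun (d.π.toFun x) ++ _
    rw [d3 i σ x hx hk hi, c3 i _ _ (d.π.mem x hx) (by rwa [d.π.len x hx])
      (by rwa [d.π.len x hx])]
    rfl

lemma unravelable_iff [Inhabited A] {T : Set (List A)} {P : Set (ℕ → A)} : Unravelable T P ↔
    ∀ k : ℕ, ∃ (B : Type u) (S : Set (List B)) (c : Covering S T),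
      IsTree S ∧ IsPruned S ∧ S.Nonempty ∧ IsFixing k c ∧
      ClopenIn S (bodyMap c.π.toFun ⁻¹' P) := by
  simp only [← isClopen_body_iff]
  rfl

lemma Unravelable.congr [Inhabited A] {T : Set (List A)} {P Q : Set (ℕ → A)}
    (h : ∀ a ∈ body T, a ∈ P ↔ a ∈ Q) (hP : Unravelable T P) : Unravelable T Q := by
  rw [unravelable_iff] at hP ⊢
  intro k
  obtain ⟨B, S, c, h1, h2, h3, h4, h5⟩ := hP k
  exact ⟨B, S, c, h1, h2, h3, h4, h5.congr fun a ha => h _ (bodyMap_mem _ ha)⟩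

lemma Unravelable.compl [Inhabited A] {T : Set (List A)} {P : Set (ℕ → A)}
    (hP : Unravelable T P) : Unravelable T Pᶜ := by
  rw [unravelable_iff] at hP ⊢
  intro k
  obtain ⟨B, S, c, h1, h2, h3, h4, h5⟩ := hP k
  exact ⟨B, S, c, h1, h2, h3, h4, h5.compl⟩

lemma UnivUnravelable.congr [Inhabited A] {T : Set (List A)} {P Q : Set (ℕ → A)}
    (h : ∀ a ∈ body T, a ∈ P ↔ a ∈ Q) (hP : UnivUnravelable T P) : UnivUnravelable T Q :=
  fun B _ S c h1 h2 h3 =>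
    (hP B _ S c h1 h2 h3).congr fun _ ha => h _ (bodyMap_mem c.π ha)

lemma UnivUnravelable.compl [Inhabited A] {T : Set (List A)} {P : Set (ℕ → A)}
    (hP : UnivUnravelable T P) : UnivUnravelable T Pᶜ :=
  fun B _ S c h1 h2 h3 => (hP B _ S c h1 h2 h3).compl

lemma UnivUnravelable.unravelable [Inhabited A] {T : Set (List A)} {P : Set (ℕ → A)}
    (hP : UnivUnravelable T P) (h1 : IsTree T) (h2 : IsPruned T) (h3 : T.Nonempty) :
    Unravelable T P :=
  (hP A _ T (Covering.refl T) h1 h2 h3).congr fun a ha => by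
    change bodyMap (TreeHom.id T).toFun a ∈ P ↔ _
    rw [bodyMap_id ha]

lemma UnivUnravelable.preimage [Inhabited A] [Inhabited B] {T : Set (List A)} {P : Set (ℕ → A)}
    (hP : UnivUnravelable T P) {S : Set (List B)} (c : Covering S T) :
    UnivUnravelable S (bodyMap c.π.toFun ⁻¹' P) :=
  fun D _ R d h1 h2 h3 => (hP D _ R (c.comp d) h1 h2 h3).congr fun a ha => by
    change bodyMap (c.π.comp d.π).toFun a ∈ P ↔ _
    rw [bodyMap_comp _ _ ha]; rfl

end Coverings

end GS

namespace GS

section Limit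

/-- A nonempty pruned tree, bundled with its (inhabited) alphabet. -/
structure PTree where
  A : Type u
  inh : Inhabited A
  T : Set (List A)
  tree : IsTree T
  pruned : IsPruned T
  ne : T.Nonempty

attribute [instance] PTree.inh

open Classical in
/-- Replace the irrelevant values of a strategy by a default value. -/
noncomputable def Strategy.norm {A : Type u} [Inhabited A] {T : Set (List A)} {i : ℕ}
    (σ : Strategy T i) : Strategy T i where
  move x := if x ∈ T ∧ x.length % 2 = i % 2 then σ.move x else default
  legal x hx hi := by rw [if_pos ⟨hx, hi⟩]; exact σ.legal x hx hi

lemma Strategy.norm_move {A : Type u} [Inhabited A] {T : Set (List A)} {i : ℕ}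
    (σ : Strategy T i) {x : List A} (hx : x ∈ T) (hi : x.length % 2 = i % 2) :
    σ.norm.move x = σ.move x := if_pos ⟨hx, hi⟩

lemma plays_congr {A : Type u} {T : Set (List A)} {i : ℕ} {σ τ : Strategy T i}
    (h : ∀ x ∈ T, x.length % 2 = i % 2 → σ.move x = τ.move x) {a : ℕ → A} (ha : a ∈ plays σ) :
    a ∈ plays τ := by
  rw [mem_plays] at ha ⊢
  refine ⟨ha.1, fun n hn => ?_⟩
  rw [ha.2 n hn]
  exact h _ (ha.1 n) (by simpa using hn)

lemma Covering.norm_agree {A B : Type u} [Inhabited A] [Inhabited B] {T : Set (List A)}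
    {S : Set (List B)} (c : Covering S T) {i n : ℕ} {σ σ' : Strategy S i}
    (h : ∀ x ∈ S, x.length ≤ n → x.length % 2 = i % 2 → σ.move x = σ'.move x) :
    ∀ x ∈ T, x.length ≤ n → (c.φ i σ.norm).move x = (c.φ i σ'.norm).move x := by
  refine c.agree i n _ _ fun x hx hn => ?_
  by_cases hi : x.length % 2 = i % 2
  · rw [σ.norm_move hx hi, σ'.norm_move hx hi, h x hx hn hi]
  · simp [Strategy.norm, hi]

variable {X : ℕ → PTree.{u}} (d : ∀ n, Covering (X (n + 1)).T (X n).T)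

/-- The inverse limit of a sequence of trees. -/
def limTree : Set (List (∀ n, (X n).A)) :=
  {x | ∀ n, x.map (· n) ∈ (X n).T ∧ (d n).π.toFun (x.map (· (n + 1))) = x.map (· n)}

/-- The projections from the inverse limit. -/
def limProj (n : ℕ) : TreeHom (limTree d) (X n).T where
  toFun x := x.map (· n)
  mem _ hx := (hx n).1
  len x _ := by simp
  mono x y _ _ h := h.map _

variable {d}

lemma isTree_limTree : IsTree (limTree d) := by
  intro x y hxy hy n
  have h (m : ℕ) : x.map (· m) ∈ (X m).T := (X m).tree (hxy.map _) (hy m).1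
  refine ⟨h n, ?_⟩
  have h1 := (d n).π.mono (h (n + 1)) (hy (n + 1)).1 (hxy.map _)
  rw [(hy n).2] at h1
  have h2 : x.map (· n) <+: y.map (· n) := hxy.map _
  apply List.IsPrefix.eq_of_length
  · exact List.prefix_of_prefix_length_le h1 h2 (by simp [(d n).π.len _ (h (n + 1))])
  · simp [(d n).π.len _ (h (n + 1))]

lemma eq_of_map_eval {x y : List (∀ n, (X n).A)} (h : ∀ n, x.map (· n) = y.map (· n)) :
    x = y := by
  have hl : x.length = y.length := by simpa using congrArg List.length (h 0)
  refine List.ext_getElem hl fun j h1 h2 => ?_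
  funext n
  have := List.getElem_of_eq (h n) (i := j) (by simpa using h1)
  simpa using this

variable {k : ℕ}

lemma limTree_inj (hd : ∀ n, IsFixing (k + n) (d n)) {x y : List (∀ n, (X n).A)}
    (hx : x ∈ limTree d) (hy : y ∈ limTree d) {n : ℕ} (hk : x.length ≤ k + n)
    (h : x.map (· n) = y.map (· n)) : x = y := by
  apply eq_of_map_eval
  intro m
  rcases le_total n m with hm | hm
  · induction m, hm using Nat.le_induction with
    | base => exact h
    | succ m hm ih =>
      refine (isFixing_iff.1 (hd m)).1 _ (hx _).1 _ (hy _).1 (by simp; omega) ?_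
      rw [(hx m).2, (hy m).2, ih]
  · induction hm using Nat.decreasingInduction with
    | self => exact h
    | of_succ m hm ih => rw [← (hx m).2, ← (hy m).2, ih]

lemma exists_thread (n : ℕ) : ∀ {X : ℕ → PTree.{u}} {d : ∀ n, Covering (X (n + 1)).T (X n).T}
    {k : ℕ} (_ : ∀ n, IsFixing (k + n) (d n)) {y : List (X n).A} (_ : y ∈ (X n).T)
    (_ : y.length ≤ k + n), ∃ t : ∀ m, List (X m).A,
      (∀ m, t m ∈ (X m).T ∧ (d m).π.toFun (t (m + 1)) = t m) ∧ t n = y := by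
  induction n with
  | zero =>
    intro X d k hd y hy hk
    have step (m : ℕ) (x : {x : List (X m).A // x ∈ (X m).T ∧ x.length ≤ k}) :
        ∃ z : {x : List (X (m + 1)).A // x ∈ (X (m + 1)).T ∧ x.length ≤ k},
          (d m).π.toFun z.1 = x.1 := by
      obtain ⟨z, hz, hzx⟩ := (isFixing_iff.1 (hd m)).2.1 x.1 x.2.1 (by have := x.2.2; omega)
      exact ⟨⟨z, hz, by rw [← (d m).π.len z hz, hzx]; exact x.2.2⟩, hzx⟩
    choose f hf using step
    let t : ∀ m, {x : List (X m).A // x ∈ (X m).T ∧ x.length ≤ k} :=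
      fun m => Nat.rec ⟨y, hy, hk⟩ (fun m x => f m x) m
    exact ⟨fun m => (t m).1, fun m => ⟨(t m).2.1, hf m (t m)⟩, rfl⟩
  | succ n ih =>
    intro X d k hd y hy hk
    obtain ⟨t, ht, hty⟩ := @ih (fun m => X (m + 1)) (fun m => d (m + 1)) (k + 1)
      (fun m => by have := hd (m + 1); rwa [show k + 1 + m = k + (m + 1) by omega]) y hy
      (by omega)
    refine ⟨fun m => Nat.casesOn m ((d 0).π.toFun (t 0)) t, fun m => ?_, hty⟩
    cases m with
    | zero => exact ⟨(d 0).π.mem _ (ht 0).1, rfl⟩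
    | succ m => exact ht m

lemma limTree_surj (hd : ∀ n, IsFixing (k + n) (d n)) {n : ℕ} {y : List (X n).A}
    (hy : y ∈ (X n).T) (hk : y.length ≤ k + n) : ∃ x ∈ limTree d, x.map (· n) = y := by
  obtain ⟨t, ht, rfl⟩ := exists_thread n hd hy hk
  have hl (m : ℕ) : (t m).length = (t 0).length := by
    induction m with
    | zero => rfl
    | succ m ih => rw [← ih, ← (ht m).2, (d m).π.len _ (ht (m + 1)).1]
  have key (m : ℕ) : (List.ofFn fun (j : Fin (t 0).length) (m : ℕ) =>
      (t m)[j.1]'(j.2.trans_eq (hl m).symm)).map (· m) = t m := by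
    apply List.ext_getElem
    · simp [hl m]
    · intro j h1 h2; simp
  refine ⟨_, fun m => ?_, key n⟩
  rw [key, key]
  exact ht m

lemma limTree_pruned (hd : ∀ n, IsFixing (k + n) (d n)) : IsPruned (limTree d) := by
  intro x hx
  obtain ⟨a, ha⟩ := (X (x.length + 1)).pruned _ (hx (x.length + 1)).1
  obtain ⟨y, hy, hya⟩ := limTree_surj hd ha (by simp)
  have hyl : y.length = x.length + 1 := by simpa using congrArg List.length hya
  have hyn : y ≠ [] := by rintro rfl; simp at hyl
  refine ⟨y.getLast hyn, ?_⟩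
  have hyx : y.dropLast = x := by
    apply limTree_inj hd (isTree_limTree (List.dropLast_prefix y) hy) hx (n := x.length + 1)
    · simp [hyl]; omega
    · rw [List.map_dropLast, hya, List.dropLast_concat]
  rw [← hyx, List.dropLast_append_getLast]
  exact hy

lemma limTree_nonempty : (limTree d).Nonempty := by
  have h (n : ℕ) : ([] : List (X n).A) ∈ (X n).T := by
    obtain ⟨x, hx⟩ := (X n).ne
    exact (X n).tree (List.nil_prefix) hx
  exact ⟨[], fun n => ⟨h n, List.eq_nil_of_length_eq_zero ((d n).π.len _ (h (n + 1)))⟩⟩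

open Classical in
/-- A lift of a node of a tree in the sequence to the inverse limit. -/
noncomputable def limLift (d : ∀ n, Covering (X (n + 1)).T (X n).T) (n : ℕ)
    (x : List (X n).A) : List (∀ n, (X n).A) :=
  if h : ∃ y ∈ limTree d, y.map (· n) = x then h.choose else []

lemma limLift_spec (hd : ∀ n, IsFixing (k + n) (d n)) {n : ℕ} {x : List (X n).A}
    (hx : x ∈ (X n).T) (hk : x.length ≤ k + n) :
    limLift d n x ∈ limTree d ∧ (limLift d n x).map (· n) = x := by
  have h := limTree_surj hd hx hk
  rw [limLift, dif_pos h]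
  exact h.choose_spec

lemma limLift_map (hd : ∀ n, IsFixing (k + n) (d n)) {n : ℕ} {x : List (∀ n, (X n).A)}
    (hx : x ∈ limTree d) (hk : x.length ≤ k + n) : limLift d n (x.map (· n)) = x := by
  have h := limLift_spec hd (hx n).1 (by simpa using hk)
  exact limTree_inj hd h.1 hx (by simpa using (congrArg List.length h.2).le.trans (by simpa)) h.2

variable {i : ℕ}

open Classical in
/-- The strategy on the `n`-th tree that follows a given strategy on the inverse limit up to
level `k + n`. -/
noncomputable def limApprox (k : ℕ) (σ : Strategy (limTree d) i) (n : ℕ) :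
    Strategy (X n).T i where
  move x :=
    if x.length < k + n ∧ x ++ [σ.move (limLift d n x) n] ∈ (X n).T then σ.move (limLift d n x) n
    else if h : ∃ a, x ++ [a] ∈ (X n).T then h.choose else default
  legal x hx _ := by
    split_ifs with h1 h2
    · exact h1.2
    · exact h2.choose_spec
    · exact absurd ((X n).pruned x hx) h2

lemma limApprox_map (hd : ∀ n, IsFixing (k + n) (d n)) (σ : Strategy (limTree d) i) {n : ℕ}
    {x : List (∀ n, (X n).A)} (hx : x ∈ limTree d) (hk : x.length < k + n)
    (hi : x.length % 2 = i % 2) : (limApprox k σ n).move (x.map (· n)) = σ.move x n := by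
  have h := (σ.legal x hx hi n).1
  rw [List.map_append] at h
  have h1 := limLift_map hd hx hk.le
  simp only [limApprox]
  rw [if_pos ⟨by simpa using hk, by rw [h1]; exact h⟩, h1]

lemma limApprox_agree (hd : ∀ n, IsFixing (k + n) (d n)) {σ τ : Strategy (limTree d) i} {N : ℕ}
    (h : ∀ x ∈ limTree d, x.length ≤ N → σ.move x = τ.move x) {n : ℕ} {x : List (X n).A}
    (hx : x ∈ (X n).T) (hN : x.length ≤ N) :
    (limApprox k σ n).move x = (limApprox k τ n).move x := by
  by_cases hk : x.length < k + n
  · have h1 := limLift_spec hd hx hk.le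
    have h2 : σ.move (limLift d n x) = τ.move (limLift d n x) :=
      h _ h1.1 (by simpa using (congrArg List.length h1.2).le.trans hN)
    simp only [limApprox, hk, true_and]
    rw [h2]
  · simp [limApprox, hk]

/-- Pull the approximation on the `(n + e)`-th tree back to the `n`-th tree. -/
noncomputable def limIter (k : ℕ) (σ : Strategy (limTree d) i) :
    ℕ → ∀ n, Strategy (X n).T i
  | 0, n => limApprox k σ n
  | e + 1, n => (d n).φ i (limIter k σ e (n + 1)).norm

lemma limIter_succ (hd : ∀ n, IsFixing (k + n) (d n)) (σ : Strategy (limTree d) i) (e : ℕ) :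
    ∀ n, ∀ x ∈ (X n).T, x.length % 2 = i % 2 → x.length < k + n + e →
      (limIter k σ (e + 1) n).move x = (limIter k σ e n).move x := by
  induction e with
  | zero =>
    intro n x hx hi hk
    obtain ⟨z, hz, rfl⟩ := limTree_surj hd hx hk.le
    simp only [List.length_map] at hi hk
    have h1 := (isFixing_iff.1 (hd n)).2.2 i (limApprox k σ (n + 1)).norm
      (z.map (· (n + 1))) (hz (n + 1)).1 (by simpa using hk) (by simpa using hi)
    rw [Strategy.norm_move _ (hz (n + 1)).1 (by simpa using hi),
      limApprox_map hd σ hz (by omega) hi, (hz n).2] at h1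
    have h2 := (σ.legal z hz hi n).2
    rw [List.map_append, List.map_append] at h2
    have h3 := h1.symm.trans h2
    simp only [List.map_cons, List.map_nil, List.append_cancel_left_eq, List.cons.injEq,
      and_true] at h3
    rw [limIter, limIter, limIter, h3, limApprox_map hd σ hz (by omega) hi]
  | succ e ih =>
    intro n x hx hi hk
    refine (d n).norm_agree (n := x.length) (fun y hy hyx hyi => ?_) x hx le_rfl
    exact ih (n + 1) y hy hyi (by omega)

lemma limIter_eq (hd : ∀ n, IsFixing (k + n) (d n)) (σ : Strategy (limTree d) i) {e e' : ℕ}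
    (hee : e ≤ e') {n : ℕ} {x : List (X n).A} (hx : x ∈ (X n).T) (hi : x.length % 2 = i % 2)
    (hk : x.length < k + n + e) :
    (limIter k σ e' n).move x = (limIter k σ e n).move x := by
  induction e', hee using Nat.le_induction with
  | base => rfl
  | succ m hm ih => rw [limIter_succ hd σ m n x hx hi (by omega), ih]

/-- The strategy induced on the `n`-th tree by a strategy on the inverse limit. -/
noncomputable def limStrat (k : ℕ) (σ : Strategy (limTree d) i) (n : ℕ) :
    Strategy (X n).T i where
  move x := (limIter k σ (x.length + 1) n).move x
  legal x hx hi := (limIter k σ (x.length + 1) n).legal x hx hi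

lemma limStrat_step (hd : ∀ n, IsFixing (k + n) (d n)) (σ : Strategy (limTree d) i) (n : ℕ)
    {x : List (X n).A} (hx : x ∈ (X n).T) (hi : x.length % 2 = i % 2) :
    (limStrat k σ n).move x = ((d n).φ i (limStrat k σ (n + 1)).norm).move x := by
  change (limIter k σ (x.length + 1) n).move x = _
  rw [← limIter_eq hd σ (Nat.le_succ _) hx hi (by omega)]
  refine (d n).norm_agree (n := x.length) (fun y hy hyx hyi => ?_) x hx le_rfl
  exact limIter_eq hd σ (by omega) hy hyi (by omega)

lemma limStrat_map (hd : ∀ n, IsFixing (k + n) (d n)) (σ : Strategy (limTree d) i) {n : ℕ}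
    {x : List (∀ n, (X n).A)} (hx : x ∈ limTree d) (hk : x.length < k + n)
    (hi : x.length % 2 = i % 2) : (limStrat k σ n).move (x.map (· n)) = σ.move x n := by
  rw [← limApprox_map hd σ hx hk hi]
  exact limIter_eq hd σ (Nat.zero_le _) (hx n).1 (by simpa using hi) (by simpa using hk)

lemma limStrat_agree (hd : ∀ n, IsFixing (k + n) (d n)) {σ τ : Strategy (limTree d) i} {N : ℕ}
    (h : ∀ x ∈ limTree d, x.length ≤ N → σ.move x = τ.move x) {n : ℕ} {x : List (X n).A}
    (hx : x ∈ (X n).T) (hN : x.length ≤ N) :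
    (limStrat k σ n).move x = (limStrat k τ n).move x := by
  have key (e : ℕ) : ∀ n, ∀ x ∈ (X n).T, x.length ≤ N →
      (limIter k σ e n).move x = (limIter k τ e n).move x := by
    induction e with
    | zero => exact fun n x hx hN => limApprox_agree hd h hx hN
    | succ e ih =>
      exact fun n => (d n).norm_agree (fun y hy hyN _ => ih (n + 1) y hy hyN)
  exact key _ n x hx hN

lemma limStrat_lift (hd : ∀ n, IsFixing (k + n) (d n)) (σ : Strategy (limTree d) i)
    {a : ℕ → (X 0).A} (ha : a ∈ plays (limStrat k σ 0)) :
    ∃ b ∈ plays σ, bodyMap (limProj d 0).toFun b = a := by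
  have step (n : ℕ) (a : {a // a ∈ plays (limStrat k σ n)}) :
      ∃ b : {a // a ∈ plays (limStrat k σ (n + 1))}, bodyMap (d n).π.toFun b.1 = a.1 := by
    obtain ⟨b, hb, hba⟩ := (d n).lift i (limStrat k σ (n + 1)).norm a.1
      (plays_congr (fun x hx hi => limStrat_step hd σ n hx hi) a.2)
    exact ⟨⟨b, plays_congr (fun x hx hi => Strategy.norm_move _ hx hi) hb⟩, hba⟩
  choose f hf using step
  let t : ∀ n, {a // a ∈ plays (limStrat k σ n)} :=
    fun n => Nat.rec ⟨a, ha⟩ (fun n x => f n x) n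
  have ht (n : ℕ) : bodyMap (d n).π.toFun (t (n + 1)).1 = (t n).1 := hf n (t n)
  let b : ℕ → ∀ n, (X n).A := fun j n => (t n).1 j
  have hb (j n : ℕ) : (pre b j).map (· n) = pre (t n).1 j := map_pre _ _ _
  have hbS (j : ℕ) : pre b j ∈ limTree d := by
    intro n
    rw [hb, hb]
    refine ⟨(t n).2.1 j, ?_⟩
    rw [← pre_bodyMap _ (t (n + 1)).2.1, ht]
  refine ⟨b, ?_, ?_⟩
  · rw [mem_plays]
    refine ⟨hbS, fun j hj => ?_⟩
    have hj' : (pre b j).length % 2 = i % 2 := by simpa using hj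
    have h1 : pre b (j + 1) = pre b j ++ [σ.move (pre b j)] := by
      apply limTree_inj hd (hbS _) (σ.legal _ (hbS j) hj') (n := j + 1)
      · simp
      · rw [List.map_append, hb, hb, pre_succ]
        have h2 := limStrat_map hd σ (n := j + 1) (hbS j) (by simp; omega) hj'
        rw [hb] at h2
        rw [(mem_plays.1 (t (j + 1)).2).2 j hj, h2]
        rfl
    rw [pre_succ] at h1
    simpa using h1
  · apply eq_of_pre_eq
    intro n
    rw [pre_bodyMap _ hbS]
    exact hb n 0

/-- The covering of the first tree by the inverse limit. -/
noncomputable def limCovering (hd : ∀ n, IsFixing (k + n) (d n)) :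
    Covering (limTree d) (X 0).T where
  π := limProj d 0
  φ _ σ := limStrat k σ 0
  agree _ _ _ _ h _ hx hN := limStrat_agree hd h hx hN
  lift _ σ _ ha := limStrat_lift hd σ ha

lemma isFixing_limCovering (hd : ∀ n, IsFixing (k + n) (d n)) :
    IsFixing k (limCovering hd) := by
  rw [isFixing_iff]
  refine ⟨fun x hx y hy hk h => limTree_inj hd hx hy (n := 0) hk h,
    fun y hy hk => limTree_surj hd hy hk, fun i σ x hx hk hi => ?_⟩
  change (x ++ [σ.move x]).map (· 0) = x.map (· 0) ++ [(limStrat k σ 0).move (x.map (· 0))]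
  rw [limStrat_map hd σ hx hk hi, List.map_append]
  rfl

lemma bodyMap_limProj_succ (n : ℕ) {a : ℕ → ∀ n, (X n).A} (ha : a ∈ body (limTree d)) :
    bodyMap (d n).π.toFun (bodyMap (limProj d (n + 1)).toFun a) =
      bodyMap (limProj d n).toFun a := by
  apply eq_of_pre_eq
  intro j
  rw [pre_bodyMap _ (bodyMap_mem _ ha), pre_bodyMap _ ha, pre_bodyMap _ ha]
  exact (ha j n).2

end Limit

section Union

/-- A tree covering a given tree. -/
structure Stage (Y : PTree.{u}) where
  X : PTree.{u}
  c : Covering X.T Y.T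

lemma exists_covering_isOpen (Y : PTree.{u}) {P : ℕ → Set (ℕ → Y.A)}
    (hP : ∀ n, UnivUnravelable Y.T (P n)) (k : ℕ) :
    ∃ (X : PTree.{u}) (c : Covering X.T Y.T), IsFixing k c ∧
      @IsOpen _ (bodyTop X.T) {a | a.1 ∈ bodyMap c.π.toFun ⁻¹' ⋃ n, P n} := by
  have step (n : ℕ) (s : Stage Y) : ∃ (Z : PTree.{u}) (e : Covering Z.T s.X.T),
      IsFixing (k + n) e ∧
        ClopenIn Z.T (bodyMap e.π.toFun ⁻¹' (bodyMap s.c.π.toFun ⁻¹' P n)) := by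
    have h := hP n s.X.A s.X.inh s.X.T s.c s.X.tree s.X.pruned s.X.ne
    rw [unravelable_iff] at h
    obtain ⟨B, S, c, h1, h2, h3, h4, h5⟩ := h (k + n)
    obtain ⟨x, hx⟩ := h3
    obtain ⟨b, -⟩ := h2 x hx
    exact ⟨⟨B, ⟨b⟩, S, h1, h2, ⟨x, hx⟩⟩, c, h4, h5⟩
  choose Z e he hcl using step
  let s : ℕ → Stage Y :=
    fun n => Nat.rec ⟨Y, Covering.refl _⟩ (fun n s => ⟨Z n s, s.c.comp (e n s)⟩) n
  let X : ℕ → PTree.{u} := fun n => (s n).X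
  let d : ∀ n, Covering (X (n + 1)).T (X n).T := fun n => e n (s n)
  have hd (n : ℕ) : IsFixing (k + n) (d n) := he n (s n)
  refine ⟨⟨_, inferInstance, limTree d, isTree_limTree, limTree_pruned hd, limTree_nonempty⟩,
    limCovering hd, isFixing_limCovering hd, ?_⟩
  have hproj (n : ℕ) {a : ℕ → ∀ n, (X n).A} (ha : a ∈ body (limTree d)) :
      bodyMap (s n).c.π.toFun (bodyMap (limProj d n).toFun a) =
        bodyMap (limProj d 0).toFun a := by
    induction n with
    | zero => exact bodyMap_id (bodyMap_mem (limProj d 0) ha)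
    | succ n ih =>
      rw [← ih, ← bodyMap_limProj_succ n ha]
      exact bodyMap_comp _ _ (bodyMap_mem (limProj d (n + 1)) ha)
  have hopen (n : ℕ) : @IsOpen _ (bodyTop (limTree d))
      {a | a.1 ∈ bodyMap (limProj d 0).toFun ⁻¹' P n} := by
    refine isOpen_congr_body (fun a ha => ?_) ((hcl n (s n)).preimage (limProj d (n + 1))).1
    change bodyMap (s n).c.π.toFun (bodyMap (d n).π.toFun
      (bodyMap (limProj d (n + 1)).toFun a)) ∈ P n ↔ _
    rw [bodyMap_limProj_succ n ha, hproj n ha]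
    rfl
  let tt := bodyTop (limTree d)
  have := isOpen_iUnion hopen
  convert this using 1
  ext a
  rw [Set.mem_iUnion]
  exact Set.mem_iUnion

end Union

end GS

namespace GS

section Reach

variable {A : Type u}

/-- The positions from which player `i` can force the play to reach `U`. -/
inductive Win (T U : Set (List A)) (i : ℕ) : List A → Prop
  | base (x : List A) : x ∈ U → Win T U i x
  | own (x : List A) (a : A) : x.length % 2 = i % 2 → x ++ [a] ∈ T → Win T U i (x ++ [a]) →
      Win T U i x
  | opp (x : List A) : x.length % 2 ≠ i % 2 → (∀ a, x ++ [a] ∈ T → Win T U i (x ++ [a])) →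
      Win T U i x

/-- Player `i` reaches `U` from `x` by making the moves suggested by `f` whenever they are
legal. -/
def Forces (T U : Set (List A)) (i : ℕ) (x : List A) (f : List A → A) : Prop :=
  ∀ a ∈ body T, pre a x.length = x →
    (∀ n ≥ x.length, n % 2 = i % 2 → pre a n ++ [f (pre a n)] ∈ T → a n = f (pre a n)) →
    ∃ n ≥ x.length, pre a n ∈ U

open Classical in
lemma Win.forces [Inhabited A] {T U : Set (List A)} {i : ℕ} {x : List A} (h : Win T U i x) :
    ∃ f, Forces T U i x f := by
  induction h with
  | base x hx => exact ⟨fun _ => default, fun a _ h _ => ⟨x.length, le_rfl, by rwa [h]⟩⟩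
  | own x b hi hb _ ih =>
    obtain ⟨f, hf⟩ := ih
    refine ⟨fun y => if y = x then b else f y, fun a ha hx hn => ?_⟩
    have hab : a x.length = b := by
      have h1 := hn x.length le_rfl hi
      simp only [hx, if_pos] at h1
      exact h1 hb
    obtain ⟨n, h1, h2⟩ := hf a ha (by simp [pre_succ, hx, hab]) fun n hn' hi' hT => by
      have hne : pre a n ≠ x := by
        intro h
        have := congrArg List.length h
        simp at this hn'; omega
      have h1 := hn n (by simp at hn'; omega) hi'
      simp only [if_neg hne] at h1
      exact h1 hT
    exact ⟨n, by simp at h1; omega, h2⟩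
  | opp x hi _ ih =>
    have ih' : ∀ b, ∃ f, x ++ [b] ∈ T → Forces T U i (x ++ [b]) f := by
      intro b
      by_cases hb : x ++ [b] ∈ T
      · obtain ⟨f, hf⟩ := ih b hb
        exact ⟨f, fun _ => hf⟩
      · exact ⟨fun _ => default, fun h => absurd h hb⟩
    choose f hf using ih'
    refine ⟨fun y => f (y.getD x.length default) y, fun a ha hx hn => ?_⟩
    have hxa : pre a (x.length + 1) = x ++ [a x.length] := by rw [pre_succ, hx]
    obtain ⟨n, h1, h2⟩ := hf (a x.length) (hxa ▸ ha (x.length + 1)) a ha (by simpa using hxa)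
      fun n hn' hi' hT => by
        have hlt : x.length < n := by simp at hn'; omega
        have he : (pre a n).getD x.length default = a x.length := by
          rw [List.getD_eq_getElem _ _ (by simpa)]; simp
        have h1 := hn n hlt.le hi'
        simp only [he] at h1
        exact h1 hT
    exact ⟨n, by simp at h1; omega, h2⟩

open Classical in
/-- A choice of moves that reaches `U` from `x` whenever this is possible. -/
noncomputable def reach [Inhabited A] (T U : Set (List A)) (i : ℕ) (x : List A) : List A → A :=
  if h : ∃ f, Forces T U i x f then h.choose else fun _ => default

lemma Win.forces_reach [Inhabited A] {T U : Set (List A)} {i : ℕ} {x : List A}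
    (h : Win T U i x) : Forces T U i x (reach T U i x) := by
  rw [reach, dif_pos h.forces]
  exact h.forces.choose_spec

lemma exists_not_win {T U : Set (List A)} {i : ℕ} (hT : IsPruned T) {x : List A} (hx : x ∈ T)
    (h : ¬ Win T U i x) : ∃ a, x ++ [a] ∈ T ∧ ¬ Win T U i (x ++ [a]) := by
  by_cases hi : x.length % 2 = i % 2
  · obtain ⟨a, ha⟩ := hT x hx
    exact ⟨a, ha, fun h' => h (.own x a hi ha h')⟩
  · by_contra! hc
    exact h (.opp x hi hc)

end Reach

section Auxiliary

variable {A : Type u}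

/-- The label carried by the `n`-th move in the auxiliary game. -/
def lbl (k : ℕ) (l : Set (List A) × Set (List A)) (n : ℕ) : Set (List A) :=
  if n < k then ∅ else if n = k then l.1 else l.2

/-- The position in the auxiliary game with moves `x` and labels `l`. -/
def mk (k : ℕ) (l : Set (List A) × Set (List A)) (x : List A) : List (A × Set (List A)) :=
  x.mapIdx fun n a => (a, lbl k l n)

/-- `Q` is a quasistrategy of player `j` in `G` starting from the position `p`. -/
structure QuasiStrategy (j : ℕ) (G : Set (List A)) (p : List A) (Q : Set (List A)) : Prop where
  mem : p ∈ Q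
  sub : ∀ x ∈ Q, p <+: x → x ∈ G
  ext : ∀ x ∈ Q, p <+: x → ∃ a, x ++ [a] ∈ Q
  free : ∀ x ∈ Q, p <+: x → x.length % 2 ≠ j → ∀ a, x ++ [a] ∈ G → x ++ [a] ∈ Q

/-- The nodes of `T` comparable with `u`. -/
def cmp (T : Set (List A)) (u : List A) : Set (List A) := {z ∈ T | z <+: u ∨ u <+: z}

/-- The legal answers of the second player to the quasistrategy `L` at the position `p`:
either the nodes comparable with a node in `W` allowed by `L`, or a quasistrategy in `L`
avoiding `W`. -/
def Answer (T W : Set (List A)) (L : Set (List A)) (p : List A) (L' : Set (List A)) : Prop :=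
  (∃ u ∈ L, u ∈ W ∧ p <+: u ∧ L' = cmp T u) ∨
    (QuasiStrategy 1 L p L' ∧ ∀ z ∈ L', p <+: z → z ∉ W)

/-- The legal positions of the auxiliary game. -/
structure Valid (k : ℕ) (T W : Set (List A)) (l : Set (List A) × Set (List A))
    (x : List A) : Prop where
  mem : x ∈ T
  fst : k + 1 ≤ x.length → QuasiStrategy 0 T (x.take (k + 1)) l.1
  mem_fst : k + 2 ≤ x.length → x.take (k + 2) ∈ l.1
  snd : k + 2 ≤ x.length → Answer T W l.1 (x.take (k + 2)) l.2
  mem_snd : ∀ n, k + 2 ≤ n → n ≤ x.length → x.take n ∈ l.2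

/-- The tree of the auxiliary game. -/
def auxTree (k : ℕ) (T W : Set (List A)) : Set (List (A × Set (List A))) :=
  {y | ∃ l x, Valid k T W l x ∧ y = mk k l x}

variable {k : ℕ} {T W : Set (List A)} {l l' : Set (List A) × Set (List A)} {x : List A}

lemma lbl_of_lt {n : ℕ} (h : n < k) : lbl k l n = ∅ := if_pos h

lemma lbl_self : lbl k l k = l.1 := by simp [lbl]

lemma lbl_of_gt {n : ℕ} (h : k < n) : lbl k l n = l.2 := by
  rw [lbl, if_neg (by omega), if_neg (by omega)]

@[simp] lemma length_mk : (mk k l x).length = x.length := by simp [mk]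

lemma map_fst_mk : (mk k l x).map Prod.fst = x := by
  apply List.ext_getElem <;> simp [mk]

lemma mk_append (a : A) : mk k l (x ++ [a]) = mk k l x ++ [(a, lbl k l x.length)] := by
  simp [mk, List.mapIdx_append]

lemma mk_take (n : ℕ) : (mk k l x).take n = mk k l (x.take n) := by
  apply List.ext_getElem <;> simp [mk]

lemma mk_congr (h1 : k + 1 ≤ x.length → l.1 = l'.1) (h2 : k + 2 ≤ x.length → l.2 = l'.2) :
    mk k l x = mk k l' x := by
  apply List.ext_getElem
  · simp
  · intro n hn _
    have hn' : n < x.length := by simpa using hn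
    simp only [mk, List.getElem_mapIdx, Prod.mk.injEq, true_and]
    rcases lt_trichotomy n k with h | h | h
    · rw [lbl_of_lt h, lbl_of_lt h]
    · rw [h, lbl_self, lbl_self, h1 (by omega)]
    · rw [lbl_of_gt h, lbl_of_gt h, h2 (by omega)]

lemma mk_inj {y : List A} (h : mk k l x = mk k l' y) :
    x = y ∧ (k + 1 ≤ x.length → l.1 = l'.1) ∧ (k + 2 ≤ x.length → l.2 = l'.2) := by
  have hxy : x = y := by simpa [map_fst_mk] using congrArg (List.map Prod.fst) h
  subst hxy
  have key (n : ℕ) (hn : n < x.length) : lbl k l n = lbl k l' n := by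
    have := List.getElem_of_eq h (i := n) (by simpa)
    simpa [mk] using this
  refine ⟨rfl, fun h1 => ?_, fun h2 => ?_⟩
  · simpa [lbl_self] using key k h1
  · simpa [lbl_of_gt] using key (k + 1) h2

lemma pre_eq_mk {b : ℕ → A × Set (List A)} {n : ℕ} (h : ∀ j < n, (b j).2 = lbl k l j) :
    pre b n = mk k l (pre (fun j => (b j).1) n) := by
  apply List.ext_getElem
  · simp
  · intro j h1 h2
    rw [length_pre] at h1
    simp only [mk, List.getElem_mapIdx, getElem_pre]
    rw [← h j h1]

lemma Valid.congr (h : Valid k T W l x) (h1 : k + 1 ≤ x.length → l.1 = l'.1)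
    (h2 : k + 2 ≤ x.length → l.2 = l'.2) : Valid k T W l' x where
  mem := h.mem
  fst hx := h1 hx ▸ h.fst hx
  mem_fst hx := h1 (by omega) ▸ h.mem_fst hx
  snd hx := h1 (by omega) ▸ h2 hx ▸ h.snd hx
  mem_snd n hn hx := h2 (by omega) ▸ h.mem_snd n hn hx

lemma Valid.take (hT : IsTree T) (h : Valid k T W l x) (n : ℕ) : Valid k T W l (x.take n) where
  mem := hT (List.take_prefix _ _) h.mem
  fst hx := by
    rw [List.length_take] at hx
    rw [List.take_take, min_eq_left (by omega)]; exact h.fst (by omega)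
  mem_fst hx := by
    rw [List.length_take] at hx
    rw [List.take_take, min_eq_left (by omega)]; exact h.mem_fst (by omega)
  snd hx := by
    rw [List.length_take] at hx
    rw [List.take_take, min_eq_left (by omega)]; exact h.snd (by omega)
  mem_snd m hm hx := by
    rw [List.length_take] at hx
    rw [List.take_take, min_eq_left (by omega)]; exact h.mem_snd m hm (by omega)

lemma mk_mem_auxTree : mk k l x ∈ auxTree k T W ↔ Valid k T W l x := by
  constructor
  · rintro ⟨l', y, h, hy⟩
    obtain ⟨rfl, h1, h2⟩ := mk_inj hy
    exact h.congr (fun h => (h1 h).symm) (fun h => (h2 h).symm)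
  · exact fun h => ⟨l, x, h, rfl⟩

lemma isTree_auxTree (hT : IsTree T) : IsTree (auxTree k T W) := by
  rintro y _ hy ⟨l, x, h, rfl⟩
  rw [List.prefix_iff_eq_take.1 hy, mk_take]
  exact mk_mem_auxTree.2 (h.take hT _)

lemma Valid.of_le (hx : x ∈ T) (hk : x.length ≤ k) : Valid k T W l x where
  mem := hx
  fst h := by omega
  mem_fst h := by omega
  snd h := by omega
  mem_snd n h h' := by omega

lemma Valid.of_eq (hx : x ∈ T) (hk : x.length = k + 1) (h : QuasiStrategy 0 T x l.1) :
    Valid k T W l x where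
  mem := hx
  fst _ := by rwa [List.take_of_length_le hk.le]
  mem_fst h := by omega
  snd h := by omega
  mem_snd n h h' := by omega

lemma Valid.fst_sub (h : Valid k T W l x) (hx : k + 1 ≤ x.length) {z : List A} (hz : z ∈ l.1)
    (hxz : x.take (k + 1) <+: z) : z ∈ T := (h.fst hx).sub z hz hxz

lemma take_prefix_take {m n : ℕ} (h : m ≤ n) : x.take m <+: x.take n := by
  rw [← min_eq_left h, ← List.take_take]; exact List.take_prefix _ _

lemma Valid.snd_sub (h : Valid k T W l x) (hx : k + 2 ≤ x.length) {z : List A} (hz : z ∈ l.2)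
    (hxz : x.take (k + 2) <+: z) : z ∈ T := by
  rcases h.snd hx with ⟨u, _, _, _, h4⟩ | ⟨h1, _⟩
  · rw [h4] at hz
    exact hz.1
  · exact h.fst_sub (by omega) (h1.sub z hz hxz)
      ((take_prefix_take (by omega)).trans hxz)

lemma Valid.append (h : Valid k T W l x) (hx : k + 2 ≤ x.length) {a : A} (ha : x ++ [a] ∈ l.2) :
    Valid k T W l (x ++ [a]) where
  mem := h.snd_sub hx ha ((List.take_prefix _ _).trans (List.prefix_append _ _))
  fst _ := by rw [List.take_append_of_le_length (by omega)]; exact h.fst (by omega)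
  mem_fst _ := by rw [List.take_append_of_le_length (by omega)]; exact h.mem_fst hx
  snd _ := by rw [List.take_append_of_le_length (by omega)]; exact h.snd hx
  mem_snd n hn hnx := by
    rcases (show n ≤ x.length ∨ n = x.length + 1 by simp at hnx; omega) with h' | rfl
    · rw [List.take_append_of_le_length h']; exact h.mem_snd n hn h'
    · rwa [List.take_of_length_le (by simp)]

lemma Valid.append_answer (h : Valid k T W l x) (hx : x.length = k + 1) {a : A}
    (ha : x ++ [a] ∈ l.1) {L' : Set (List A)} (hL : Answer T W l.1 (x ++ [a]) L')
    (haL : x ++ [a] ∈ L') : Valid k T W (l.1, L') (x ++ [a]) where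
  mem := h.fst_sub hx.ge ha ((List.take_prefix _ _).trans (List.prefix_append _ _))
  fst _ := by rw [List.take_append_of_le_length (by omega)]; exact h.fst (by omega)
  mem_fst _ := by rwa [List.take_of_length_le (by simp [hx])]
  snd _ := by rwa [List.take_of_length_le (by simp [hx])]
  mem_snd n hn hnx := by rwa [List.take_of_length_le (by simp [hx]; omega)]

lemma QuasiStrategy.refl (hT : IsPruned T) {p : List A} (hp : p ∈ T) (j : ℕ) :
    QuasiStrategy j T p T where
  mem := hp
  sub _ hx _ := hx
  ext x hx _ := hT x hx
  free _ _ _ _ _ h := h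

lemma exists_cmp_append (hT : IsTree T) (hp : IsPruned T) {u : List A} (hu : u ∈ T)
    (hx : x ∈ cmp T u) : ∃ a, x ++ [a] ∈ cmp T u := by
  obtain ⟨hxT, h⟩ := hx
  by_cases hux : u <+: x
  · obtain ⟨a, ha⟩ := hp x hxT
    exact ⟨a, ha, Or.inr (hux.trans (List.prefix_append _ _))⟩
  · obtain ⟨t, rfl⟩ := h.resolve_right hux
    cases t with
    | nil => simp at hux
    | cons a t =>
      have h2 : x ++ [a] <+: x ++ a :: t := ⟨t, by simp⟩
      exact ⟨a, hT h2 hu, Or.inl h2⟩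

lemma isPruned_auxTree (hT : IsTree T) (hp : IsPruned T) : IsPruned (auxTree k T W) := by
  rintro _ ⟨l, x, h, rfl⟩
  suffices ∃ l' a, mk k l' x = mk k l x ∧ Valid k T W l' (x ++ [a]) by
    obtain ⟨l', a, h1, h2⟩ := this
    exact ⟨(a, lbl k l' x.length), by rw [← h1, ← mk_append]; exact mk_mem_auxTree.2 h2⟩
  rcases lt_or_ge x.length k with hx | hx
  · obtain ⟨a, ha⟩ := hp x h.mem
    exact ⟨l, a, rfl, .of_le ha (by simpa using hx)⟩
  rcases hx.eq_or_lt with hx | hx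
  · obtain ⟨a, ha⟩ := hp x h.mem
    exact ⟨(T, l.2), a, mk_congr (by omega) (by omega), .of_eq ha (by simp [hx])
      (.refl hp ha 0)⟩
  rcases (show k + 1 ≤ x.length from hx).eq_or_lt with hx | hx
  · have hq := h.fst hx.le
    rw [List.take_of_length_le hx.ge] at hq
    obtain ⟨a, ha⟩ := hq.ext x hq.mem (List.prefix_refl _)
    have haT : x ++ [a] ∈ T := hq.sub _ ha (List.prefix_append _ _)
    by_cases hu : ∃ u ∈ l.1, u ∈ W ∧ x ++ [a] <+: u
    · obtain ⟨u, h1, h2, h3⟩ := hu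
      exact ⟨(l.1, cmp T u), a, mk_congr (fun _ => rfl) (by omega),
        h.append_answer hx.symm ha (Or.inl ⟨u, h1, h2, h3, rfl⟩) ⟨haT, Or.inl h3⟩⟩
    · refine ⟨(l.1, l.1), a, mk_congr (fun _ => rfl) (by omega),
        h.append_answer hx.symm ha (Or.inr ⟨⟨ha, fun _ h _ => h, fun z hz hxz => ?_,
          fun _ _ _ _ _ h => h⟩, fun z hz hxz hW => hu ⟨z, hz, hW, hxz⟩⟩) ha⟩
      exact hq.ext z hz ((List.prefix_append _ _).trans hxz)
  · have hx2 : x ∈ l.2 := by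
      have := h.mem_snd x.length hx le_rfl
      rwa [List.take_length] at this
    have hpx : x.take (k + 2) <+: x := List.take_prefix _ _
    suffices ∃ a, x ++ [a] ∈ l.2 by
      obtain ⟨a, ha⟩ := this
      exact ⟨l, a, rfl, h.append hx ha⟩
    rcases h.snd hx with ⟨u, h1, h2, h3, h4⟩ | ⟨h1, _⟩
    · rw [h4] at hx2 ⊢
      exact exists_cmp_append hT hp
        (h.fst_sub (by omega) h1 ((take_prefix_take (by omega)).trans h3)) hx2
    · exact h1.ext x hx2 hpx

lemma nil_mem (hT : IsTree T) (hne : T.Nonempty) : [] ∈ T := by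
  obtain ⟨x, hx⟩ := hne
  exact hT List.nil_prefix hx

lemma auxTree_nonempty (hT : IsTree T) (hne : T.Nonempty) : (auxTree k T W).Nonempty :=
  ⟨_, (mk_mem_auxTree (l := (∅, ∅))).2 (.of_le (nil_mem hT hne) (Nat.zero_le _))⟩

lemma exists_of_append_mem {b : A} {m : Set (List A)}
    (h : mk k l x ++ [(b, m)] ∈ auxTree k T W) :
    ∃ l', Valid k T W l' (x ++ [b]) ∧ m = lbl k l' x.length ∧ mk k l' x = mk k l x := by
  obtain ⟨l', y, hv, hy⟩ := h
  have hyx : y = x ++ [b] := by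
    simpa [map_fst_mk] using (congrArg (List.map Prod.fst) hy).symm
  subst hyx
  rw [mk_append] at hy
  obtain ⟨h1, h2⟩ := List.append_inj' hy rfl
  exact ⟨l', hv, by simpa using h2, h1.symm⟩

lemma valid_of_append_mem {b : A} {m : Set (List A)}
    (h : mk k l x ++ [(b, m)] ∈ auxTree k T W) (hk : k + 1 ≤ x.length)
    (hm : x.length = k + 1 → m = l.2) : Valid k T W l (x ++ [b]) ∧ m = lbl k l x.length := by
  obtain ⟨l', hv, rfl, h3⟩ := exists_of_append_mem h
  obtain ⟨-, h1, h2⟩ := mk_inj h3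
  have hl2 : l'.2 = l.2 := by
    rcases hk.eq_or_lt with hk | hk
    · rw [← hm hk.symm, lbl_of_gt (by omega)]
    · exact h2 hk
  refine ⟨hv.congr (fun _ => h1 hk) (fun _ => hl2), ?_⟩
  rw [lbl_of_gt (by omega), lbl_of_gt (by omega), hl2]

/-- Forgetting the labels. -/
def auxProj (k : ℕ) (T W : Set (List A)) : TreeHom (auxTree k T W) T where
  toFun := List.map Prod.fst
  mem := by
    rintro _ ⟨l, x, h, rfl⟩
    rw [map_fst_mk]; exact h.mem
  len x _ := by simp
  mono x y _ _ h := h.map _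

lemma bodyMap_auxProj [Inhabited A] {b : ℕ → A × Set (List A)} (hb : b ∈ body (auxTree k T W)) :
    bodyMap (auxProj k T W).toFun b = fun j => (b j).1 := by
  apply eq_of_pre_eq
  intro n
  rw [pre_bodyMap _ hb]
  exact map_pre _ _ _

lemma exists_labels_of_mem_body (hT : IsTree T) {b : ℕ → A × Set (List A)}
    (hb : b ∈ body (auxTree k T W)) (n : ℕ) :
    Valid k T W ((b k).2, (b (k + 1)).2) (pre (fun j => (b j).1) n) := by
  obtain ⟨l, x, hv, hx⟩ := hb (n + k + 2)
  change pre b (n + k + 2) = mk k l x at hx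
  have hxa : x = pre (fun j => (b j).1) (n + k + 2) := by
    rw [← map_pre, hx, map_fst_mk]
  subst hxa
  have key (j : ℕ) (hj : j < n + k + 2) : (b j).2 = lbl k l j := by
    have := List.getElem_of_eq hx (i := j) (by simpa)
    rw [getElem_pre] at this
    rw [this]
    simp [mk]
  have h1 := key k (by omega)
  have h2 := key (k + 1) (by omega)
  rw [lbl_self] at h1
  rw [lbl_of_gt (by omega)] at h2
  have h3 := hv.take hT n
  rw [take_pre _ (by omega)] at h3
  exact h3.congr (fun _ => h1.symm) (fun _ => h2.symm)

/-- The payoff set becomes clopen in the auxiliary game. -/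
lemma clopenIn_auxTree [Inhabited A] (hT : IsTree T) {P : Set (ℕ → A)}
    (hW : ∀ ⦃x y⦄, x <+: y → x ∈ W → y ∈ W)
    (hP : ∀ a ∈ body T, a ∈ P ↔ ∀ n, pre a n ∉ W) :
    ClopenIn (auxTree k T W) (bodyMap (auxProj k T W).toFun ⁻¹' P) := by
  have key : ∀ b ∈ body (auxTree k T W), b ∈ bodyMap (auxProj k T W).toFun ⁻¹' P ↔
      ∀ z ∈ (b (k + 1)).2, pre (fun j => (b j).1) (k + 2) <+: z → z ∉ W := by
    intro b hb
    have hv := exists_labels_of_mem_body hT hb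
    rw [Set.mem_preimage, hP _ (bodyMap_mem _ hb), bodyMap_auxProj hb]
    set a := fun j => (b j).1
    have hs := (hv (k + 2)).snd (by simp)
    rw [take_pre _ le_rfl] at hs
    constructor
    · intro h
      rcases hs with ⟨u, h1, h2, h3, h4⟩ | ⟨h1, h2⟩
      · exfalso
        apply h u.length
        have hu : k + 2 ≤ u.length := by simpa using h3.length_le
        have h5 := (hv u.length).mem_snd u.length hu (by simp)
        rw [take_pre _ le_rfl, h4] at h5
        rcases h5.2 with h6 | h6
        · rwa [h6.eq_of_length (by simp)]
        · rwa [← h6.eq_of_length (by simp)]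
      · exact h2
    · intro h n hn
      have h1 := (hv (n + k + 2)).mem_snd (n + k + 2) (by omega) (by simp)
      rw [take_pre _ le_rfl] at h1
      exact h _ h1 (pre_prefix _ (by omega)) (hW (pre_prefix _ (by omega)) hn)
  have hloc : ∀ b b' : ℕ → A × Set (List A), pre b (k + 2) = pre b' (k + 2) →
      ((∀ z ∈ (b (k + 1)).2, pre (fun j => (b j).1) (k + 2) <+: z → z ∉ W) ↔
        ∀ z ∈ (b' (k + 1)).2, pre (fun j => (b' j).1) (k + 2) <+: z → z ∉ W) := by
    intro b b' h
    rw [pre_eq_apply h (Nat.lt_succ_self _), ← map_pre, ← map_pre, h]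
  refine ⟨isOpen_body_iff.2 fun b hb => ⟨k + 2, fun b' h => ?_⟩,
    isOpen_body_iff.2 fun b hb => ⟨k + 2, fun b' h => ?_⟩⟩
  · exact (key _ b'.2).2 ((hloc _ _ h).2 ((key _ b.2).1 hb))
  · exact fun h' => hb ((key _ b.2).2 ((hloc _ _ h).1 ((key _ b'.2).1 h')))

end Auxiliary

end GS

namespace GS

section Follow

variable {A : Type u} [Inhabited A]

open Classical in
/-- Player `i` imitates an auxiliary strategy `s` with the labels `lab₀`, until a position from
which `U` can be reached is met; then she reaches `U`, and imitates `s` with the labels `lab₁`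
from there on. -/
noncomputable def follow (k : ℕ) (T : Set (List A)) (i m : ℕ) (U : Set (List A))
    (lab₀ lab₁ : List A → Set (List A) × Set (List A))
    (s : List (A × Set (List A)) → A × Set (List A)) (x : List A) : A :=
  if h : ∃ n, n ≤ x.length ∧ x.take n ∈ U then (s (mk k (lab₁ (x.take (Nat.find h))) x)).1
  else if h : ∃ n, n ≤ x.length ∧ m ≤ n ∧ Win T U i (x.take n) then
    reach T U i (x.take (Nat.find h)) x
  else (s (mk k (lab₀ (x.take m)) x)).1

variable {k : ℕ} {T W U : Set (List A)} {i m : ℕ}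
  {lab₀ lab₁ : List A → Set (List A) × Set (List A)}
  {s s' : List (A × Set (List A)) → A × Set (List A)} {a : ℕ → A} {n N : ℕ}

lemma follow_of_mem (hN : pre a N ∈ U) (hlt : ∀ j < N, pre a j ∉ U) (hn : N ≤ n) :
    follow k T i m U lab₀ lab₁ s (pre a n) = (s (mk k (lab₁ (pre a N)) (pre a n))).1 := by
  classical
  have h : ∃ j, j ≤ (pre a n).length ∧ (pre a n).take j ∈ U :=
    ⟨N, by simpa, by rwa [take_pre _ hn]⟩
  have hf : Nat.find h = N := by
    rw [Nat.find_eq_iff]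
    refine ⟨⟨by simpa, by rwa [take_pre _ hn]⟩, fun j hj h' => hlt j hj ?_⟩
    rw [← take_pre a (hj.le.trans hn)]; exact h'.2
  rw [follow, dif_pos h, hf, take_pre _ hn]

lemma follow_of_win (hU : ∀ j, pre a j ∉ U) (hN : Win T U i (pre a N)) (hm : m ≤ N)
    (hlt : ∀ j < N, m ≤ j → ¬ Win T U i (pre a j)) (hn : N ≤ n) :
    follow k T i m U lab₀ lab₁ s (pre a n) = reach T U i (pre a N) (pre a n) := by
  classical
  have h0 : ¬ ∃ j, j ≤ (pre a n).length ∧ (pre a n).take j ∈ U := by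
    rintro ⟨j, h1, h2⟩
    rw [take_pre _ (by simpa using h1)] at h2
    exact hU j h2
  have h : ∃ j, j ≤ (pre a n).length ∧ m ≤ j ∧ Win T U i ((pre a n).take j) :=
    ⟨N, by simpa, hm, by rwa [take_pre _ hn]⟩
  have hf : Nat.find h = N := by
    rw [Nat.find_eq_iff]
    refine ⟨⟨by simpa, hm, by rwa [take_pre _ hn]⟩, fun j hj h' => hlt j hj h'.2.1 ?_⟩
    rw [← take_pre a (hj.le.trans hn)]; exact h'.2.2
  rw [follow, dif_neg h0, dif_pos h, hf, take_pre _ hn]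

lemma follow_of_not_win (hU : ∀ j, pre a j ∉ U) (hw : ∀ j, m ≤ j → ¬ Win T U i (pre a j))
    (hn : m ≤ n) :
    follow k T i m U lab₀ lab₁ s (pre a n) = (s (mk k (lab₀ (pre a m)) (pre a n))).1 := by
  have h0 : ¬ ∃ j, j ≤ (pre a n).length ∧ (pre a n).take j ∈ U := by
    rintro ⟨j, h1, h2⟩
    rw [take_pre _ (by simpa using h1)] at h2
    exact hU j h2
  have h : ¬ ∃ j, j ≤ (pre a n).length ∧ m ≤ j ∧ Win T U i ((pre a n).take j) := by
    rintro ⟨j, h1, h2, h3⟩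
    rw [take_pre _ (by simpa using h1)] at h3
    exact hw j h2 h3
  rw [follow, dif_neg h0, dif_neg h, take_pre _ hn]

/-- The play `a` with labels `l` follows `σ` at the `n`-th move. -/
def Obeys (σ : Strategy (auxTree k T W) i) (l : Set (List A) × Set (List A)) (a : ℕ → A)
    (n : ℕ) : Prop :=
  n % 2 = i % 2 → σ.move (mk k l (pre a n)) = (a n, lbl k l n)

lemma exists_labels_of_follow {σ : Strategy (auxTree k T W) i}
    {s : ℕ → List (A × Set (List A)) → A × Set (List A)} (hT : IsTree T) (ha : a ∈ body T)
    (hs : ∀ n l, Valid k T W l (pre a n) → s n (mk k l (pre a n)) = σ.move (mk k l (pre a n)))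
    (hkm : k + 1 ≤ m)
    (hmove : ∀ n, k < n → n % 2 = i % 2 →
      pre a n ++ [follow k T i m U lab₀ lab₁ (s n) (pre a n)] ∈ T →
      a n = follow k T i m U lab₀ lab₁ (s n) (pre a n))
    (h₁ : ∀ N, pre a N ∈ U → k + 2 ≤ N ∧ (lab₁ (pre a N)).2 = cmp T (pre a N) ∧
      (∀ n, Valid k T W (lab₁ (pre a N)) (pre a n)) ∧
      ∀ n ≤ k + 1, Obeys σ (lab₁ (pre a N)) a n)
    (h₀ : (∀ n, pre a n ∉ U) → (∀ n, m ≤ n → ¬ Win T U i (pre a n)) →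
      Valid k T W (lab₀ (pre a m)) (pre a m) ∧ (∀ n < m, Obeys σ (lab₀ (pre a m)) a n) ∧
      (m = k + 1 → m % 2 = i % 2 →
        (σ.move (mk k (lab₀ (pre a m)) (pre a m))).2 = (lab₀ (pre a m)).2) ∧
      ∀ n, m ≤ n → n % 2 ≠ i % 2 → (∀ j < n, Obeys σ (lab₀ (pre a m)) a j) →
        Valid k T W (lab₀ (pre a m)) (pre a n) → Valid k T W (lab₀ (pre a m)) (pre a (n + 1))) :
    ∃ l, ∀ n, Valid k T W l (pre a n) ∧ Obeys σ l a n := by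
  classical
  have hleg : ∀ l n, Valid k T W l (pre a n) → k + 1 ≤ n → n % 2 = i % 2 →
      (n = k + 1 → (σ.move (mk k l (pre a n))).2 = l.2) →
      Valid k T W l (pre a n ++ [(σ.move (mk k l (pre a n))).1]) ∧
        (σ.move (mk k l (pre a n))).2 = lbl k l n := by
    intro l n hv hk hn h
    have := valid_of_append_mem (σ.legal _ (mk_mem_auxTree.2 hv) (by simpa))
      (by simpa) (by simpa)
    simpa using this
  by_cases hU : ∃ N, pre a N ∈ U
  · obtain ⟨N, hN, hlt⟩ : ∃ N, pre a N ∈ U ∧ ∀ j < N, pre a j ∉ U :=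
      ⟨Nat.find hU, Nat.find_spec hU, fun j hj => Nat.find_min hU hj⟩
    obtain ⟨h1, h2, h3, h4⟩ := h₁ N hN
    refine ⟨lab₁ (pre a N), fun n => ⟨h3 n, ?_⟩⟩
    rcases le_or_gt n (k + 1) with hn | hn
    · exact h4 n hn
    intro hi
    obtain ⟨h5, h6⟩ := hleg _ n (h3 n) hn.le hi (by omega)
    refine Prod.ext ?_ h6
    change _ = a n
    rcases le_or_gt N n with hNn | hNn
    · have h7 := hmove n (by omega) hi
      rw [follow_of_mem hN hlt hNn, hs _ _ (h3 n)] at h7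
      exact (h7 h5.mem).symm
    · have h7 := h5.mem_snd (n + 1) (by omega) (by simp)
      rw [List.take_of_length_le (by simp), h2] at h7
      have h8 : pre a n ++ [(σ.move (mk k (lab₁ (pre a N)) (pre a n))).1] <+: pre a N := by
        rcases h7.2 with h8 | h8
        · exact h8
        · rw [← h8.eq_of_length (by have := h8.length_le; simp at this ⊢; omega)]
      have h9 := prefix_pre_eq h8
      simp only [List.length_append, length_pre, List.length_singleton, pre_succ] at h9
      simpa using h9
  push Not at hU
  have hw : ∀ n, m ≤ n → ¬ Win T U i (pre a n) := by
    by_contra hw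
    push Not at hw
    obtain ⟨N, ⟨h1, h2⟩, hlt⟩ : ∃ N, (m ≤ N ∧ Win T U i (pre a N)) ∧
        ∀ j < N, ¬ (m ≤ j ∧ Win T U i (pre a j)) :=
      ⟨Nat.find hw, Nat.find_spec hw, fun j hj => Nat.find_min hw hj⟩
    obtain ⟨n, -, hn⟩ := h2.forces_reach a ha (by simp) fun n hn hi hleg' => by
      rw [length_pre] at hn
      have h3 := hmove n (by omega) hi
      rw [follow_of_win hU h2 h1 (fun j hj h h' => hlt j hj ⟨h, h'⟩) hn] at h3
      exact h3 hleg'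
    exact hU n hn
  obtain ⟨h1, h2, h3, h4⟩ := h₀ hU hw
  set l := lab₀ (pre a m) with hl
  have key : ∀ n, m ≤ n → Valid k T W l (pre a n) ∧ ∀ j < n, Obeys σ l a j := by
    intro n hn
    induction n, hn using Nat.le_induction with
    | base => exact ⟨h1, h2⟩
    | succ n hn ih =>
      obtain ⟨ihv, iho⟩ := ih
      by_cases hi : n % 2 = i % 2
      · obtain ⟨h5, h6⟩ := hleg l n ihv (by omega) hi (by
          rintro rfl
          have : m = k + 1 := by omega
          subst this
          exact h3 rfl hi)
        have h7 := hmove n (by omega) hi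
        rw [follow_of_not_win hU hw hn, hs _ _ ihv] at h7
        have h8 := h7 h5.mem
        refine ⟨by rw [pre_succ, h8]; exact h5, fun j hj => ?_⟩
        rcases (Nat.lt_succ_iff.1 hj).eq_or_lt with rfl | hj
        · exact fun _ => Prod.ext h8.symm h6
        · exact iho j hj
      · refine ⟨h4 n hn hi iho ihv, fun j hj => ?_⟩
        rcases (Nat.lt_succ_iff.1 hj).eq_or_lt with rfl | hj
        · exact fun h => absurd h hi
        · exact iho j hj
  refine ⟨l, fun n => ?_⟩
  obtain ⟨h5, h6⟩ := key (n + m + 1) (by omega)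
  have := h5.take hT n
  rw [take_pre _ (by omega)] at this
  exact ⟨this, h6 n (by omega)⟩

end Follow

end GS

namespace GS

section Transfer

variable {A B : Type u}

open Classical in
/-- The part of a strategy that concerns positions of length at most `n`. -/
noncomputable def Strategy.upTo [Inhabited B] {S : Set (List B)} {i : ℕ} (σ : Strategy S i) (n : ℕ)
    (y : List B) : B :=
  if y ∈ S ∧ y.length ≤ n then σ.move y else default

lemma Strategy.upTo_eq [Inhabited B] {S : Set (List B)} {i n : ℕ} (σ : Strategy S i) {y : List B} (hy : y ∈ S)
    (hn : y.length ≤ n) : σ.upTo n y = σ.move y := if_pos ⟨hy, hn⟩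

lemma Strategy.upTo_congr [Inhabited B] {S : Set (List B)} {i m n : ℕ} {σ σ' : Strategy S i}
    (h : ∀ x ∈ S, x.length ≤ n → σ.move x = σ'.move x) (hm : m ≤ n) : σ.upTo m = σ'.upTo m := by
  funext y
  rw [upTo, upTo]
  split_ifs with hy
  · exact h y hy.1 (hy.2.trans hm)
  · rfl

open Classical in
/-- Replace an illegal move by a legal one. -/
noncomputable def legalize (T : Set (List A)) (x : List A) (c : A) : A :=
  if x ++ [c] ∈ T then c else if h : ∃ b, x ++ [b] ∈ T then h.choose else c

lemma legalize_of_mem {T : Set (List A)} {x : List A} {c : A} (h : x ++ [c] ∈ T) :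
    legalize T x c = c := if_pos h

lemma legalize_mem {T : Set (List A)} (hp : IsPruned T) {x : List A} (hx : x ∈ T) (c : A) :
    x ++ [legalize T x c] ∈ T := by
  rw [legalize]
  split_ifs with h1 h2
  · exact h1
  · exact h2.choose_spec
  · exact absurd (hp x hx) h2

/-- The quasistrategy played by the first player after the position `x.take k`. -/
def firstLabel (k : ℕ) (t : List (A × Set (List A)) → A × Set (List A)) (x : List A) :
    Set (List A) :=
  (t (mk k (∅, ∅) (x.take k))).2

/-- The positions in which the first player wins by having the second player aim at them. -/
def target₁ (k : ℕ) (W : Set (List A)) (t : List (A × Set (List A)) → A × Set (List A)) :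
    Set (List A) :=
  {z | k + 2 ≤ z.length ∧ z ∈ W ∧ z ∈ firstLabel k t z}

/-- The second player answers the quasistrategy `L` by aiming at `u`. -/
structure AimsAt (k : ℕ) (T W : Set (List A)) (t : List (A × Set (List A)) → A × Set (List A))
    (u : List A) (L : Set (List A)) : Prop where
  le : k + 2 ≤ u.length
  mem_W : u ∈ W
  mem : u ∈ L
  legal : mk k (L, ∅) (u.take (k + 1)) ∈ auxTree k T W
  move : ∃ b, t (mk k (L, ∅) (u.take (k + 1))) = (b, cmp T u) ∧
    u.take (k + 2) = u.take (k + 1) ++ [b]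

/-- The positions the second player aims at in answer to some quasistrategy. -/
def target₂ (k : ℕ) (T W : Set (List A)) (t : List (A × Set (List A)) → A × Set (List A)) :
    Set (List A) :=
  {u | ∃ L, AimsAt k T W t u L}

open Classical in
/-- A quasistrategy that makes the second player aim at `u`. -/
noncomputable def bait (k : ℕ) (T W : Set (List A))
    (t : List (A × Set (List A)) → A × Set (List A)) (u : List A) : Set (List A) :=
  if h : ∃ L, AimsAt k T W t u L then h.choose else ∅

lemma aimsAt_bait {k : ℕ} {T W : Set (List A)} {t : List (A × Set (List A)) → A × Set (List A)}
    {u : List A} (h : u ∈ target₂ k T W t) : AimsAt k T W t u (bait k T W t u) := by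
  have h' : ∃ L, AimsAt k T W t u L := h
  rw [bait, dif_pos h']
  exact h'.choose_spec

/-- The positions of `T` from which player `i` cannot reach `U`. -/
def avoid (T U : Set (List A)) (i : ℕ) : Set (List A) := {z ∈ T | ¬ Win T U i z}

/-- The move suggested by the auxiliary strategy that is given by `t` up to length `k + 1` and by
`s` at the current length. -/
noncomputable def suggest [Inhabited A] (k : ℕ) (T W : Set (List A)) (i : ℕ)
    (t s : List (A × Set (List A)) → A × Set (List A)) (x : List A) : A :=
  if x.length ≤ k then (s (mk k (∅, ∅) x)).1
  else if i % 2 = 0 then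
    follow k T i (k + 2) (target₁ k W t)
      (fun p => (firstLabel k t p, {z ∈ firstLabel k t p | ¬ Win T (target₁ k W t) i z}))
      (fun q => (firstLabel k t q, cmp T q)) s x
  else
    follow k T i (k + 1) (target₂ k T W t)
      (fun p => (avoid T (target₂ k T W t) i,
        (t (mk k (avoid T (target₂ k T W t) i, ∅) (p.take (k + 1)))).2))
      (fun q => (bait k T W t q, cmp T q)) s x

variable {k : ℕ} {T W : Set (List A)} {i : ℕ} {a : ℕ → A}

lemma exists_valid_move {σ : Strategy (auxTree k T W) i} {l : Set (List A) × Set (List A)}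
    {x : List A} (hx : Valid k T W l x) (hi : x.length % 2 = i % 2) :
    ∃ l', Valid k T W l' (x ++ [(σ.move (mk k l x)).1]) ∧
      (σ.move (mk k l x)).2 = lbl k l' x.length ∧ mk k l' x = mk k l x :=
  exists_of_append_mem (b := (σ.move (mk k l x)).1) (m := (σ.move (mk k l x)).2)
    (σ.legal _ (mk_mem_auxTree.2 hx) (by simpa))

lemma valid_cmp {L : Set (List A)} (ha : a ∈ body T) (hL : QuasiStrategy 0 T (pre a (k + 1)) L)
    (h2 : pre a (k + 2) ∈ L) {N : ℕ} (hN : k + 2 ≤ N) (hNL : pre a N ∈ L) (hNW : pre a N ∈ W)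
    (n : ℕ) : Valid k T W (L, cmp T (pre a N)) (pre a n) where
  mem := ha n
  fst hn := by rw [length_pre] at hn; rwa [take_pre _ hn]
  mem_fst hn := by rw [length_pre] at hn; rwa [take_pre _ hn]
  snd hn := by
    rw [length_pre] at hn
    rw [take_pre _ hn]
    exact Or.inl ⟨_, hNL, hNW, pre_prefix a hN, rfl⟩
  mem_snd j hj hn := by
    rw [length_pre] at hn
    rw [take_pre _ hn]
    exact ⟨ha j, (le_total j N).imp (pre_prefix a) (pre_prefix a)⟩

variable [Inhabited A]

/-- The strategy in `T` induced by a strategy in the auxiliary game. -/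
noncomputable def transfer (hp : IsPruned T) (σ : Strategy (auxTree k T W) i) : Strategy T i where
  move x := legalize T x (suggest k T W i (σ.upTo (k + 1)) (σ.upTo x.length) x)
  legal _ hx _ := legalize_mem hp hx _

lemma transfer_agree (hp : IsPruned T) {n : ℕ} {σ σ' : Strategy (auxTree k T W) i}
    (h : ∀ x ∈ auxTree k T W, x.length ≤ n → σ.move x = σ'.move x) {x : List A}
    (hx : x.length ≤ n) : (transfer hp σ).move x = (transfer hp σ').move x := by
  simp only [transfer]
  rw [Strategy.upTo_congr h hx]
  rcases le_or_gt x.length k with hk | hk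
  · simp only [suggest, if_pos hk]
  · rw [Strategy.upTo_congr h (show k + 1 ≤ n by omega)]

lemma transfer_move_of_mem (hp : IsPruned T) (σ : Strategy (auxTree k T W) i) {x : List A}
    (h : x ++ [suggest k T W i (σ.upTo (k + 1)) (σ.upTo x.length) x] ∈ T) :
    (transfer hp σ).move x = suggest k T W i (σ.upTo (k + 1)) (σ.upTo x.length) x :=
  legalize_of_mem h

lemma transfer_move_of_lt (hp : IsPruned T) (σ : Strategy (auxTree k T W) i)
    {l : Set (List A) × Set (List A)} {x : List A} (hx : x ∈ T) (hk : x.length ≤ k)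
    (hi : x.length % 2 = i % 2) : (transfer hp σ).move x = (σ.move (mk k l x)).1 := by
  have hv : Valid k T W l x := .of_le hx hk
  have hmk : mk k (∅, ∅) x = mk k l x := mk_congr (by omega) (by omega)
  have hs : suggest k T W i (σ.upTo (k + 1)) (σ.upTo x.length) x = (σ.move (mk k l x)).1 := by
    rw [suggest, if_pos hk, hmk, σ.upTo_eq (mk_mem_auxTree.2 hv) (by simp)]
  obtain ⟨l', h1, -, -⟩ := exists_valid_move (σ := σ) hv hi
  rw [transfer_move_of_mem, hs]
  rw [hs]; exact h1.mem

lemma exists_valid_succ (hp : IsPruned T) (σ : Strategy (auxTree k T W) i)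
    (ha : a ∈ plays (transfer hp σ)) {n : ℕ} (hn : n ≤ k) (hi : n % 2 = i % 2)
    (l : Set (List A) × Set (List A)) :
    ∃ l', Valid k T W l' (pre a (n + 1)) ∧ σ.move (mk k l (pre a n)) = (a n, lbl k l' n) := by
  have h1 := transfer_move_of_lt hp σ (l := l) (ha.1 n) (by simpa [pre] using hn)
    (by simpa [pre] using hi)
  change _ = (σ.move (mk k l (pre a n))).1 at h1
  rw [← ha.2 n hi] at h1
  obtain ⟨l', h2, h3, -⟩ := exists_valid_move (σ := σ) (l := l)
    (.of_le (ha.1 n) (by simpa [pre] using hn)) (by simpa [pre] using hi)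
  change Valid k T W l' (pre a n ++ [(σ.move (mk k l (pre a n))).1]) at h2
  change (σ.move (mk k l (pre a n))).2 = lbl k l' (pre a n).length at h3
  rw [← h1, ← pre_succ] at h2
  rw [length_pre] at h3
  exact ⟨l', h2, Prod.ext h1.symm h3⟩

lemma obeys_of_lt (hp : IsPruned T) (σ : Strategy (auxTree k T W) i)
    (ha : a ∈ plays (transfer hp σ)) {n : ℕ} (hn : n < k)
    (l : Set (List A) × Set (List A)) : Obeys σ l a n := by
  intro hi
  obtain ⟨l', -, h⟩ := exists_valid_succ hp σ ha hn.le hi l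
  rw [h, lbl_of_lt hn, lbl_of_lt hn]

lemma move_eq_of_mem_plays (hp : IsPruned T) (σ : Strategy (auxTree k T W) i)
    (ha : a ∈ plays (transfer hp σ)) {n : ℕ} (hi : n % 2 = i % 2) {c : A}
    (hc : suggest k T W i (σ.upTo (k + 1)) (σ.upTo n) (pre a n) = c)
    (h : pre a n ++ [c] ∈ T) : a n = c := by
  have h1 : a n = (transfer hp σ).move (pre a n) := ha.2 n hi
  rw [h1, transfer_move_of_mem, length_pre, hc]
  rwa [length_pre, hc]

lemma exists_labels_first (hT : IsTree T) (hp : IsPruned T) (hk : k % 2 = 0) (hi0 : i % 2 = 0)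
    (σ : Strategy (auxTree k T W) i) (ha : a ∈ plays (transfer hp σ)) :
    ∃ l, ∀ n, Valid k T W l (pre a n) ∧ Obeys σ l a n := by
  set t := σ.upTo (k + 1) with ht
  obtain ⟨l₀, hv, hmk⟩ := exists_valid_succ hp σ ha le_rfl (hk.trans hi0.symm) (∅, ∅)
  set L := l₀.1 with hL
  have hq : QuasiStrategy 0 T (pre a (k + 1)) L := by
    have := hv.fst (by simp)
    rwa [take_pre _ le_rfl] at this
  have hlab : ∀ n, k ≤ n → firstLabel k t (pre a n) = L := by
    intro n hn
    have hmem : pre a k ∈ T := ha.1 k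
    rw [firstLabel, take_pre _ hn, ht,
      σ.upTo_eq (mk_mem_auxTree.2 (.of_le hmem (by simp))) (by simp), hmk, lbl_self]
  have hmemL : ∀ n, k + 1 ≤ n → n % 2 ≠ 0 → pre a n ∈ L → pre a (n + 1) ∈ L := by
    intro n hn h2 hmem
    rw [pre_succ]
    refine hq.free _ hmem (pre_prefix a hn) (by simpa using h2) _ ?_
    rw [← pre_succ]; exact ha.1 _
  have h2L : pre a (k + 2) ∈ L := hmemL (k + 1) le_rfl (by omega) hq.mem
  have hobey : ∀ l, l.1 = L → ∀ n ≤ k + 1, Obeys σ l a n := by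
    intro l hl n hn
    rcases lt_trichotomy n k with h | rfl | h
    · exact obeys_of_lt hp σ ha h l
    · intro _
      rw [mk_congr (l' := (∅, ∅)) (by simp) (by simp), hmk, lbl_self, lbl_self, hl]
    · intro h'; omega
  refine exists_labels_of_follow (U := target₁ k W t) (m := k + 2) (s := fun n => σ.upTo n)
    (lab₀ := fun p => (firstLabel k t p, {z ∈ firstLabel k t p | ¬ Win T (target₁ k W t) i z}))
    (lab₁ := fun q => (firstLabel k t q, cmp T q)) hT ha.1
    (fun n l hv => σ.upTo_eq (mk_mem_auxTree.2 hv) (by simp)) (by omega) ?_ ?_ ?_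
  · intro n hn hi h
    refine move_eq_of_mem_plays hp σ ha hi ?_ h
    rw [suggest, if_neg (by simpa using hn), if_pos hi0]
  · rintro N ⟨h1, h2, h3⟩
    rw [length_pre] at h1
    rw [hlab N (by omega)] at h3
    simp only [hlab N (show k ≤ N by omega)]
    exact ⟨h1, trivial, valid_cmp ha.1 hq h2L h1 h3 h2, hobey _ rfl⟩
  · intro hU hw
    simp only [hlab (k + 2) (show k ≤ k + 2 by omega)]
    have hans : Answer T W L (pre a (k + 2)) {z ∈ L | ¬ Win T (target₁ k W t) i z} := by
      have hpz : ∀ {z}, pre a (k + 2) <+: z → pre a (k + 1) <+: z :=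
        fun h => (pre_prefix a (by omega)).trans h
      refine Or.inr ⟨⟨⟨h2L, hw _ le_rfl⟩, fun z hz _ => hz.1, fun z hz hpre => ?_,
        fun z hz hpre hj b hb => ⟨hb, fun hwin => hz.2 ?_⟩⟩, fun z hz hpre hzW => hz.2 ?_⟩
      · by_cases hzi : z.length % 2 = 0
        · obtain ⟨b, hb⟩ := hq.ext z hz.1 (hpz hpre)
          exact ⟨b, hb, fun hwin => hz.2 (.own z b (by omega) (hq.sub _ hb
            ((hpz hpre).trans (List.prefix_append _ _))) hwin)⟩
        · obtain ⟨b, hb, hb'⟩ := exists_not_win hp (hq.sub z hz.1 (hpz hpre)) hz.2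
          exact ⟨b, hq.free z hz.1 (hpz hpre) hzi b hb, hb'⟩
      · exact .own z b (by omega) (hq.sub _ hb
          ((hpz hpre).trans (List.prefix_append _ _))) hwin
      · refine .base z ⟨by simpa using hpre.length_le, hzW, ?_⟩
        have : z.take k = (pre a (k + 2)).take k := by
          obtain ⟨r, rfl⟩ := hpre
          rw [List.take_append_of_le_length (by simp)]
        rw [firstLabel, this]
        have := hlab (k + 2) (by omega)
        rw [firstLabel] at this
        rw [this]
        exact hz.1
    refine ⟨⟨ha.1 _, fun _ => ?_, fun _ => ?_, fun _ => ?_, fun n hn hn' => ?_⟩,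
      fun n hn =>
      hobey (L, {z ∈ L | ¬ Win T (target₁ k W t) i z}) rfl n (by omega), fun h => by omega, ?_⟩
    · rwa [take_pre _ (by omega)]
    · rwa [take_pre _ le_rfl]
    · rwa [take_pre _ le_rfl]
    · obtain rfl : n = k + 2 := le_antisymm (by simpa using hn') hn
      rw [take_pre _ le_rfl]
      exact ⟨h2L, hw _ le_rfl⟩
    · intro n hn hi _ hvn
      rw [pre_succ]
      refine hvn.append (by simpa) ?_
      rw [← pre_succ]
      have h1 := hvn.mem_snd n hn (by simp)
      rw [take_pre _ le_rfl] at h1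
      exact ⟨hmemL n (by omega) (by omega) h1.1, hw _ (by omega)⟩

lemma exists_labels_second (hT : IsTree T) (hp : IsPruned T) (hk : k % 2 = 0) (hi1 : i % 2 = 1)
    (σ : Strategy (auxTree k T W) i) (ha : a ∈ plays (transfer hp σ)) :
    ∃ l, ∀ n, Valid k T W l (pre a n) ∧ Obeys σ l a n := by
  set t := σ.upTo (k + 1) with ht
  have hteq : ∀ l, Valid k T W l (pre a (k + 1)) →
      t (mk k l (pre a (k + 1))) = σ.move (mk k l (pre a (k + 1))) :=
    fun l hv => σ.upTo_eq (mk_mem_auxTree.2 hv) (by simp)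
  have hobey : ∀ l, ∀ n < k + 1, Obeys σ l a n := by
    intro l n hn
    rcases (Nat.lt_succ_iff.1 hn).eq_or_lt with rfl | h
    · intro h'; omega
    · exact obeys_of_lt hp σ ha h l
  set Q := avoid T (target₂ k T W t) i with hQ
  refine exists_labels_of_follow (U := target₂ k T W t) (m := k + 1) (s := fun n => σ.upTo n)
    (lab₀ := fun p => (Q, (t (mk k (Q, ∅) (p.take (k + 1)))).2))
    (lab₁ := fun q => (bait k T W t q, cmp T q)) hT ha.1
    (fun n l hv => σ.upTo_eq (mk_mem_auxTree.2 hv) (by simp)) le_rfl ?_ ?_ ?_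
  · intro n hn hi h
    refine move_eq_of_mem_plays hp σ ha hi ?_ h
    rw [suggest, if_neg (by simpa using hn), if_neg (by omega)]
  · intro N hN
    obtain ⟨h1, h2, h3, h4, b, h5, h6⟩ := aimsAt_bait hN
    rw [length_pre] at h1
    rw [take_pre a (show k + 1 ≤ N by omega)] at h4 h5 h6
    rw [take_pre _ h1, show k + 2 = k + 1 + 1 from rfl, pre_succ] at h6
    obtain rfl : a (k + 1) = b := by simpa using h6
    set L := bait k T W t (pre a N)
    have hv := mk_mem_auxTree.1 h4
    have hq := hv.fst (by simp)
    rw [take_pre _ le_rfl] at hq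
    rw [hteq _ hv] at h5
    have hi' : (pre a (k + 1)).length % 2 = i % 2 := by simp; omega
    obtain ⟨l', hv', -, hmk⟩ := exists_valid_move (σ := σ) hv hi'
    rw [h5, ← pre_succ] at hv'
    have h2L := hv'.mem_fst (by simp)
    rw [take_pre _ le_rfl, (mk_inj hmk).2.1 (by simp)] at h2L
    refine ⟨h1, rfl, valid_cmp ha.1 hq h2L h1 h3 h2, fun n hn => ?_⟩
    rcases hn.eq_or_lt with rfl | hn
    · intro _
      rw [mk_congr (l := (L, cmp T (pre a N))) (l' := (L, ∅)) (fun _ => rfl) (by simp), h5, lbl_of_gt (Nat.lt_succ_self k)]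
    · exact hobey _ n hn
  · intro hU hw
    have hq : QuasiStrategy 0 T (pre a (k + 1)) Q := by
      refine ⟨⟨ha.1 _, hw _ le_rfl⟩, fun z hz _ => hz.1, fun z hz _ => ?_,
        fun z hz _ hj b hb => ⟨hb, fun hwin => hz.2 (.own z b (by omega) hb hwin)⟩⟩
      obtain ⟨b, hb, hb'⟩ := exists_not_win hp hz.1 hz.2
      exact ⟨b, hb, hb'⟩
    have hv : Valid k T W (Q, ∅) (pre a (k + 1)) := .of_eq (ha.1 _) (by simp) hq
    simp only [take_pre a le_rfl, hteq _ hv]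
    set L' := (σ.move (mk k (Q, ∅) (pre a (k + 1)))).2 with hL'
    have hmk : mk k (Q, L') (pre a (k + 1)) = mk k (Q, ∅) (pre a (k + 1)) :=
      mk_congr (fun _ => rfl) (by simp)
    refine ⟨.of_eq (ha.1 _) (by simp) hq, hobey _, fun _ _ => by rw [hmk], ?_⟩
    intro n hn hi hob hvn
    have hn2 : k + 2 ≤ n := by
      rcases hn.eq_or_lt with rfl | h
      · omega
      · exact h
    have h1 := hvn.mem_snd n hn2 (by simp)
    rw [take_pre _ le_rfl] at h1
    have hans := hvn.snd (by simpa)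
    rw [take_pre _ hn2] at hans
    rw [pre_succ]
    refine hvn.append (by simpa) ?_
    rcases hans with ⟨u, h3, h4, h5, h6⟩ | ⟨h3, -⟩
    · exfalso
      have hul : k + 2 ≤ u.length := by simpa using h5.length_le
      have htake : ∀ j ≤ k + 2, u.take j = pre a j := by
        intro j hj
        obtain ⟨r, rfl⟩ := h5
        rw [List.take_append_of_le_length (by simpa), take_pre _ hj]
      refine h3.2 (.base u ⟨Q, hul, h4, h3, ?_, a (k + 1), ?_, ?_⟩)
      · rw [htake _ (by omega)]
        exact mk_mem_auxTree.2 hv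
      · rw [htake _ (by omega), hteq _ hv, ← hmk, hob (k + 1) (by omega) (by omega),
          lbl_of_gt (Nat.lt_succ_self k)]
        exact Prod.ext rfl h6
      · rw [htake _ le_rfl, htake (k + 1) (by omega), ← pre_succ]
    · refine h3.free _ h1 (pre_prefix a hn2) (by simp; omega) _ ?_
      rw [← pre_succ]
      exact ⟨ha.1 _, hw _ (by omega)⟩

lemma transfer_lift (hT : IsTree T) (hp : IsPruned T) (hk : k % 2 = 0)
    (σ : Strategy (auxTree k T W) i) (ha : a ∈ plays (transfer hp σ)) :
    ∃ b ∈ plays σ, bodyMap (auxProj k T W).toFun b = a := by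
  obtain ⟨l, hl⟩ : ∃ l, ∀ n, Valid k T W l (pre a n) ∧ Obeys σ l a n := by
    rcases Nat.mod_two_eq_zero_or_one i with hi | hi
    · exact exists_labels_first hT hp hk hi σ ha
    · exact exists_labels_second hT hp hk hi σ ha
  have hpre : ∀ n, pre (fun j => (a j, lbl k l j)) n = mk k l (pre a n) :=
    fun n => pre_eq_mk fun j _ => rfl
  have hb : (fun j => (a j, lbl k l j)) ∈ body (auxTree k T W) := by
    intro n
    have := mk_mem_auxTree.2 (hl n).1
    rwa [← hpre] at this
  refine ⟨_, mem_plays.2 ⟨mem_body.1 hb, fun n hn => ?_⟩, bodyMap_auxProj hb⟩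
  rw [hpre, (hl n).2 hn]

/-- The covering of `T` by the auxiliary game. -/
noncomputable def auxCovering (W : Set (List A)) (hT : IsTree T) (hp : IsPruned T)
    (hk : k % 2 = 0) : Covering (auxTree k T W) T where
  π := auxProj k T W
  φ _ σ := transfer hp σ
  agree _ _ _ _ h _ _ hx := transfer_agree hp h hx
  lift _ σ _ ha := transfer_lift hT hp hk σ ha

lemma isFixing_auxCovering (hT : IsTree T) (hp : IsPruned T) (hk : k % 2 = 0) :
    IsFixing k (auxCovering W hT hp hk) := by
  rw [isFixing_iff]
  refine ⟨?_, ?_, ?_⟩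
  · rintro _ ⟨l, x, -, rfl⟩ _ ⟨l', y, -, rfl⟩ hx h
    change (mk k l x).map Prod.fst = (mk k l' y).map Prod.fst at h
    rw [map_fst_mk, map_fst_mk] at h
    subst h
    rw [length_mk] at hx
    exact mk_congr (by omega) (by omega)
  · intro y hy hyk
    exact ⟨_, (mk_mem_auxTree (l := (∅, ∅))).2 (.of_le hy hyk), map_fst_mk⟩
  · rintro i σ _ ⟨l, x, hv, rfl⟩ hx hi
    rw [length_mk] at hx hi
    change (mk k l x ++ [_]).map Prod.fst = (mk k l x).map Prod.fst ++
      [(transfer hp σ).move ((mk k l x).map Prod.fst)]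
    rw [map_fst_mk, List.map_append, map_fst_mk, transfer_move_of_lt hp σ hv.mem hx.le hi]
    rfl

end Transfer

end GS

namespace GS

variable {A : Type u} [Inhabited A] {T : Set (List A)} {P : Set (ℕ → A)}

lemma unravelable_of_isClosed (hT : IsTree T) (hp : IsPruned T) (hne : T.Nonempty)
    (hP : @IsOpen _ (bodyTop T) {a | a.1 ∈ Pᶜ}) : Unravelable T P := by
  rw [unravelable_iff]
  intro k
  have hk : 2 * k % 2 = 0 := by omega
  let W : Set (List A) := {x | ∀ a ∈ body T, pre a x.length = x → a ∉ P}
  have hW : ∀ ⦃x y⦄, x <+: y → x ∈ W → y ∈ W := by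
    intro x y hxy hx a ha hay
    refine hx a ha ?_
    rw [List.prefix_iff_eq_take.1 hxy, ← hay, take_pre _ hxy.length_le]
    simp
  have hPW : ∀ a ∈ body T, a ∈ P ↔ ∀ n, pre a n ∉ W := by
    intro a ha
    constructor
    · exact fun h n hn => hn a ha (by simp) h
    · intro h
      by_contra haP
      obtain ⟨n, hn⟩ := isOpen_body_iff.1 hP ⟨a, ha⟩ haP
      exact h n fun b hb hbn => hn ⟨b, hb⟩ (by simpa using hbn)
  exact ⟨_, _, auxCovering W hT hp hk, isTree_auxTree hT, isPruned_auxTree hT hp,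
    auxTree_nonempty hT hne, (isFixing_auxCovering hT hp hk).of_le (by omega),
    clopenIn_auxTree hT hW hPW⟩

lemma univUnravelable_of_isClosed (hP : @IsOpen _ (bodyTop T) {a | a.1 ∈ Pᶜ}) :
    UnivUnravelable T P :=
  fun _ _ _ c hS hp hne => unravelable_of_isClosed hS hp hne (isOpen_preimage_body c.π hP)

lemma univUnravelable_iUnion {P : ℕ → Set (ℕ → A)} (hP : ∀ n, UnivUnravelable T (P n)) :
    UnivUnravelable T (⋃ n, P n) := by
  intro B _ S c hS hp hne
  rw [unravelable_iff]
  intro k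
  let Y : PTree.{u} := ⟨B, inferInstance, S, hS, hp, hne⟩
  obtain ⟨X, d, hd, hX⟩ := exists_covering_isOpen Y (P := fun n => bodyMap c.π.toFun ⁻¹' P n)
    (fun n => (hP n).preimage c) k
  rw [← Set.preimage_iUnion] at hX
  let Q : Set (ℕ → X.A) := bodyMap d.π.toFun ⁻¹' (bodyMap c.π.toFun ⁻¹' ⋃ n, P n)
  have hU := (unravelable_of_isClosed (P := Qᶜ) X.tree X.pruned X.ne
    (by rwa [compl_compl])).compl
  rw [compl_compl, unravelable_iff] at hU
  obtain ⟨C, R, e, h1, h2, h3, h4, h5⟩ := hU k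
  refine ⟨C, R, Covering.comp (S := X.T) d e, h1, h2, h3, hd.comp h4, h5.congr fun a ha => ?_⟩
  have hcomp : bodyMap (Covering.comp (S := X.T) d e).π.toFun a = _ := bodyMap_comp d.π e.π ha
  rw [Set.mem_preimage (f := bodyMap (Covering.comp (S := X.T) d e).π.toFun), hcomp]
  rfl

/-- Every Borel subset of the body is universally unravelable. -/
lemma univUnravelable_image_of_measurableSet {X : Set {a // a ∈ body T}}
    (hX : @MeasurableSet _ (@borel _ (bodyTop T)) X) :
    UnivUnravelable T (Subtype.val '' X) := by
  let := bodyTop T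
  have hclosed : ∀ X : Set {a // a ∈ body T}, IsClosed X →
      UnivUnravelable T (Subtype.val '' X) := by
    intro X hX
    refine univUnravelable_of_isClosed ?_
    convert hX.isOpen_compl using 1
    ext a
    simp
  have hcompl : ∀ X : Set {a // a ∈ body T}, UnivUnravelable T (Subtype.val '' X) →
      UnivUnravelable T (Subtype.val '' Xᶜ) := by
    intro X hX
    refine hX.compl.congr fun a ha => ?_
    simp [ha]
  induction X, hX using MeasurableSpace.generateFrom_induction with
  | hC X hX _ =>
    rw [← compl_compl X]
    exact hcompl _ (hclosed _ (IsOpen.isClosed_compl hX))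
  | empty => exact hclosed _ isClosed_empty
  | compl X _ ih => exact hcompl _ ih
  | iUnion X _ ih =>
    rw [Set.image_iUnion]
    exact univUnravelable_iUnion ih

end GS

namespace GS
/-- Every Borel subset of the body of a nonempty pruned tree is universally unravelable,
hence unravelable. -/
theorem borel_univUnravelable {A : Type u} [Inhabited A] (T : Set (List A)) (P : Set (ℕ → A))
    (hT : IsTree T) (hpr : IsPruned T) (hne : T.Nonempty)
    (hP : @MeasurableSet _ (@borel _ (bodyTop T)) {a : {a // a ∈ body T} | a.1 ∈ P}) :
    UnivUnravelable T P ∧ Unravelable T P := by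
  have h : UnivUnravelable T P := by
    refine (univUnravelable_image_of_measurableSet hP).congr fun a ha => ?_
    simpa using fun _ => ha
  exact ⟨h, h.unravelable hT hpr hne⟩
end GS
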